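/- arXiv:1710.02656 — 2 statements merged into one kernel-verified Lean document; each statement's English description precedes it below -/
import Mathlib

section
/- Let N ≥ 2, M ≥ 2N−1 be integers, θ ∈ ℝ and β ∈ (0, π). Let q = (q_0, q_1, …, q_{N−1}) with q_0 ∈ ℝ and q_1,…,q_{N−1} ∈ ℂ, and define the trigonometric polynomial p(φ) = q_0 + 2·Re( Σ_{k=1}^{N−1} q_k e^{−ikφ} ). Then p(φ) ≥ 0 for all φ ∈ [θ−β, θ+β] if and only if there exist a positive semidefinite Hermitian matrix X₁ ∈ ℂ^{N×N} and a positive semidefinite Hermitian matrix X₂ ∈ ℂ^{(N−1)×(N−1)} such that q = Wᴴ [ diag(W X₁ Wᴴ) + d ∘ diag(W₁ X₂ W₁ᴴ) ], where ∘ denotes the entrywise (Hadamard) product, diag(A) denotes the vector of diagonal entries of A, and d ∈ ℝ^M has entries d_k = cos(2πk/M − θ) − cos β for k = 0,1,…,M−1. -/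
open Matrix ComplexOrder

open Polynomial in
/-- The cone generated by `f² (T - X)^i (T + X)^j` with total degree at most `m`. -/
noncomputable def intervalCone (T : ℝ) (m : ℕ) : AddSubmonoid (Polynomial ℝ) :=
  AddSubmonoid.closure {P | ∃ (f : Polynomial ℝ) (i j : ℕ), 2 * f.natDegree + i + j ≤ m ∧
    P = f ^ 2 * (C T - X) ^ i * (C T + X) ^ j}

section IntervalCone

open Polynomial

theorem intervalCone_mono (T : ℝ) {m m' : ℕ} (h : m ≤ m') :
    intervalCone T m ≤ intervalCone T m' := by
  apply AddSubmonoid.closure_mono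
  rintro P ⟨f, i, j, hd, rfl⟩
  exact ⟨f, i, j, hd.trans h, rfl⟩

theorem mul_mem_intervalCone {T : ℝ} {m m' : ℕ} {P Q : ℝ[X]} (hP : P ∈ intervalCone T m)
    (hQ : Q ∈ intervalCone T m') : P * Q ∈ intervalCone T (m + m') := by
  induction hP using AddSubmonoid.closure_induction with
  | zero => simp
  | add a b _ _ ha hb => rw [add_mul]; exact add_mem ha hb
  | mem a ha =>
    obtain ⟨f, i, j, hd, rfl⟩ := ha
    induction hQ using AddSubmonoid.closure_induction with
    | zero => simp
    | add a b _ _ ha hb => rw [mul_add]; exact add_mem ha hb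
    | mem b hb =>
      obtain ⟨g, k, l, hd', rfl⟩ := hb
      refine AddSubmonoid.subset_closure ⟨f * g, i + k, j + l, ?_, by ring⟩
      have := natDegree_mul_le (p := f) (q := g)
      omega

theorem sq_mem_intervalCone (T : ℝ) {m : ℕ} (f : ℝ[X]) (h : 2 * f.natDegree ≤ m) :
    f ^ 2 ∈ intervalCone T m :=
  AddSubmonoid.subset_closure ⟨f, 0, 0, by simpa using h, by simp⟩

theorem C_mem_intervalCone (T : ℝ) (m : ℕ) {c : ℝ} (hc : 0 ≤ c) :
    C c ∈ intervalCone T m := by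
  have := sq_mem_intervalCone T (m := m) (C √c) (by simp)
  rwa [← C_pow, Real.sq_sqrt hc] at this

theorem C_sub_X_mem_intervalCone {T r : ℝ} (h : T ≤ r) : C r - X ∈ intervalCone T 1 := by
  have h1 : C T - X ∈ intervalCone T 1 :=
    AddSubmonoid.subset_closure ⟨1, 1, 0, by simp, by simp⟩
  have h2 := add_mem h1 (C_mem_intervalCone T 1 (sub_nonneg.2 h))
  convert h2 using 1
  simp only [C_sub]
  ring

theorem X_sub_C_mem_intervalCone {T r : ℝ} (h : r ≤ -T) : X - C r ∈ intervalCone T 1 := by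
  have h1 : C T + X ∈ intervalCone T 1 :=
    AddSubmonoid.subset_closure ⟨1, 0, 1, by simp, by simp⟩
  have h2 := add_mem h1 (C_mem_intervalCone T 1 (sub_nonneg.2 h))
  convert h2 using 1
  simp only [C_sub, C_neg]
  ring

theorem eval_nonneg_of_nonneg_off_point (Q : ℝ[X]) {a b r : ℝ} (hab : a < b)
    (h : ∀ t ∈ Set.Ioo a b, t ≠ r → 0 ≤ Q.eval t) : ∀ t ∈ Set.Icc a b, 0 ≤ Q.eval t := by
  have hcl : IsClosed {t : ℝ | 0 ≤ Q.eval t} := isClosed_le continuous_const Q.continuous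
  have h1 : Set.Ioo a b ⊆ {t : ℝ | 0 ≤ Q.eval t} := by
    refine ((dense_compl_singleton r).open_subset_closure_inter isOpen_Ioo).trans ?_
    exact hcl.closure_subset_iff.2 fun t ht => h t ht.1 ht.2
  intro t ht
  rw [← closure_Ioo hab.ne] at ht
  exact hcl.closure_subset_iff.2 h1 ht

theorem isRoot_of_mul_nonneg (Q : ℝ[X]) {a b r : ℝ} (har : a < r) (hrb : r < b)
    (h : ∀ t ∈ Set.Icc a b, 0 ≤ (t - r) * Q.eval t) : Q.IsRoot r := by
  apply le_antisymm
  · have := eval_nonneg_of_nonneg_off_point (-Q) (r := r) har (fun t ht _ => by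
      have h1 := h t ⟨ht.1.le, (ht.2.trans hrb).le⟩
      rw [eval_neg]
      nlinarith [ht.2, pos_of_mul_neg_right (a := t - r) (b := Q.eval t)]) r ⟨har.le, le_rfl⟩
    simpa using this
  · exact eval_nonneg_of_nonneg_off_point Q (r := r) hrb (fun t ht _ =>
      nonneg_of_mul_nonneg_right (h t ⟨(har.trans ht.1).le, ht.2.le⟩) (sub_pos.2 ht.1))
      r ⟨le_rfl, hrb.le⟩

/-- Markov–Lukács: a polynomial nonnegative on `[-T, T]` lies in the cone of its degree. -/
theorem mem_intervalCone_of_nonneg {T : ℝ} (hT : 0 < T) (P : ℝ[X])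
    (hP : ∀ t ∈ Set.Icc (-T) T, 0 ≤ P.eval t) : P ∈ intervalCone T P.natDegree := by
  induction hm : P.natDegree using Nat.strong_induction_on generalizing P with
  | _ m ih =>
  rcases Nat.eq_zero_or_pos m with rfl | hpos
  · rw [eq_C_of_natDegree_eq_zero hm] at hP ⊢
    have := hP 0 ⟨by linarith, hT.le⟩
    exact C_mem_intervalCone _ _ (by simpa using this)
  have hP0 : P ≠ 0 := by rintro rfl; simp at hm; omega
  have factor_step : ∀ A Q : ℝ[X], P = A * Q → 0 < A.natDegree →
      A ∈ intervalCone T A.natDegree → (∀ t ∈ Set.Icc (-T) T, 0 ≤ Q.eval t) →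
      P ∈ intervalCone T m := by
    intro A Q h hA hAm hQ
    have hAQ : A ≠ 0 ∧ Q ≠ 0 := by
      constructor <;> rintro rfl <;> simp at h <;> exact hP0 h
    have hdeg : A.natDegree + Q.natDegree = m := by
      rw [← hm, h, natDegree_mul hAQ.1 hAQ.2]
    rw [h, ← hdeg]
    exact mul_mem_intervalCone hAm (ih _ (by omega) Q hQ rfl)
  obtain ⟨z, hz⟩ := IsAlgClosed.exists_aeval_eq_zero ℂ P
    (by rw [degree_eq_natDegree hP0, hm]; exact_mod_cast hpos.ne')
  have hlt : -T < T := by linarith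
  by_cases him : z.im = 0
  · have hroot : P.IsRoot z.re := by
      have hz' : z = ((z.re : ℝ) : ℂ) := by apply Complex.ext <;> simp [him]
      rw [hz', show ((z.re : ℝ) : ℂ) = algebraMap ℝ ℂ z.re from rfl,
        aeval_algebraMap_apply] at hz
      simpa using hz
    generalize z.re = r at hroot
    obtain ⟨Q, hQ⟩ := dvd_iff_isRoot.2 hroot
    have hev : ∀ t, P.eval t = (t - r) * Q.eval t := fun t => by simp [hQ]
    rcases le_or_gt r (-T) with h1 | h1
    · refine factor_step (X - C r) Q hQ (by simp) (by simpa using X_sub_C_mem_intervalCone h1)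
        (eval_nonneg_of_nonneg_off_point Q (r := r) hlt fun t ht _ => ?_)
      have := hP t ⟨ht.1.le, ht.2.le⟩
      rw [hev] at this
      exact nonneg_of_mul_nonneg_right this (by linarith [ht.1])
    rcases le_or_gt T r with h2 | h2
    · have hdeg : (C r - X : ℝ[X]).natDegree = 1 := by
        rw [← neg_sub, natDegree_neg, natDegree_X_sub_C]
      refine factor_step (C r - X) (-Q) (by rw [hQ]; ring) (by simp [hdeg])
        (by simpa [hdeg] using C_sub_X_mem_intervalCone h2)
        (eval_nonneg_of_nonneg_off_point (-Q) (r := r) hlt fun t ht _ => ?_)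
      have := hP t ⟨ht.1.le, ht.2.le⟩
      rw [hev] at this
      rw [eval_neg]
      exact nonneg_of_mul_nonneg_right (a := r - t) (by linarith) (by linarith [ht.2])
    · obtain ⟨R, hR⟩ := dvd_iff_isRoot.2
        (isRoot_of_mul_nonneg Q h1 h2 fun t ht => hev t ▸ hP t ht)
      refine factor_step ((X - C r) ^ 2) R (by rw [hQ, hR]; ring) (by simp)
        (sq_mem_intervalCone T _ (by simp))
        (eval_nonneg_of_nonneg_off_point R (r := r) hlt fun t ht htr => ?_)
      have := hP t ⟨ht.1.le, ht.2.le⟩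
      rw [hev, hR] at this
      simp only [eval_mul, eval_sub, eval_X, eval_C, ← mul_assoc] at this
      exact nonneg_of_mul_nonneg_right this (mul_self_pos.2 (sub_ne_zero.2 htr))
  · obtain ⟨Q, hQ⟩ := quadratic_dvd_of_aeval_eq_zero_im_ne_zero P hz him
    have hsq : (X ^ 2 - C (2 * z.re) * X + C (‖z‖ ^ 2) : ℝ[X])
        = (X - C z.re) ^ 2 + C (z.im ^ 2) := by
      rw [Complex.sq_norm, Complex.normSq_apply]
      simp only [C_mul, C_add, C_pow, map_ofNat]
      ring
    rw [hsq] at hQ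
    have hdeg : ((X - C z.re) ^ 2 + C (z.im ^ 2) : ℝ[X]).natDegree = 2 := by
      rw [natDegree_add_C]; simp
    refine factor_step _ Q hQ (by rw [hdeg]; norm_num) ?_ fun t ht => ?_
    · rw [hdeg]
      exact add_mem (sq_mem_intervalCone T _ (by simp)) (C_mem_intervalCone T _ (sq_nonneg _))
    · have := hP t ht
      rw [hQ, eval_mul] at this
      refine nonneg_of_mul_nonneg_right this ?_
      simp only [eval_add, eval_pow, eval_sub, eval_X, eval_C]
      positivity

end IntervalCone

/-- The real trigonometric polynomial with coefficient vector `q`. -/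
noncomputable def trigEval {n : ℕ} (q : Fin (n + 1) → ℂ) (φ : ℝ) : ℝ :=
  (q 0).re + 2 * (∑ k ∈ Finset.univ.filter (fun k : Fin (n + 1) => (k : ℕ) ≠ 0),
    q k * Complex.exp (-Complex.I * ((k : ℕ) : ℂ) * (φ : ℂ))).re

/-- The vector `(e^{-iaφ})_a`. -/
noncomputable def expVec (n : ℕ) (φ : ℝ) (a : Fin n) : ℂ :=
  Complex.exp (-Complex.I * ((a : ℕ) : ℂ) * (φ : ℂ))

/-- The Hermitian form of `X` evaluated at `expVec n φ`. -/
noncomputable def expForm {n : ℕ} (X : Matrix (Fin n) (Fin n) ℂ) (φ : ℝ) : ℂ :=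
  expVec n φ ⬝ᵥ (X *ᵥ star (expVec n φ))

section TrigPolynomial

theorem expForm_nonneg {n : ℕ} {X : Matrix (Fin n) (Fin n) ℂ} (hX : X.PosSemidef) (φ : ℝ) :
    0 ≤ expForm X φ := by
  simpa [expForm] using hX.dotProduct_mulVec_nonneg (star (expVec n φ))

theorem ofReal_re_expForm {n : ℕ} {X : Matrix (Fin n) (Fin n) ℂ} (hX : X.PosSemidef) (φ : ℝ) :
    ((expForm X φ).re : ℂ) = expForm X φ :=
  Complex.ext rfl (Complex.nonneg_iff.1 (expForm_nonneg hX φ)).2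

theorem expForm_add {n : ℕ} (X Y : Matrix (Fin n) (Fin n) ℂ) (φ : ℝ) :
    expForm (X + Y) φ = expForm X φ + expForm Y φ := by
  simp [expForm, add_mulVec]

theorem expForm_smul {n : ℕ} (c : ℝ) (X : Matrix (Fin n) (Fin n) ℂ) (φ : ℝ) :
    expForm (c • X) φ = c * expForm X φ := by
  simp [expForm, smul_mulVec]

theorem expForm_vecMulVec {n : ℕ} (x : Fin n → ℂ) (φ : ℝ) :
    expForm (vecMulVec x (star x)) φ = (‖expVec n φ ⬝ᵥ x‖ ^ 2 : ℝ) := by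
  rw [expForm, vecMulVec_mulVec, Complex.sq_norm, ← Complex.mul_conj, dotProduct_comm (star x)]
  simp [star_dotProduct_star, dotProduct_smul, mul_comm, dotProduct_comm x]

theorem expForm_eq_sum {n : ℕ} (X : Matrix (Fin n) (Fin n) ℂ) (φ : ℝ) :
    expForm X φ = ∑ a, ∑ b, X a b *
      Complex.exp (-Complex.I * (((a : ℕ) - (b : ℕ) : ℤ) : ℂ) * (φ : ℂ)) := by
  simp only [expForm, dotProduct, mulVec, Finset.mul_sum, expVec, Pi.star_apply]
  refine Finset.sum_congr rfl fun a _ => Finset.sum_congr rfl fun b _ => ?_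
  rw [mul_left_comm, Complex.star_def, ← Complex.exp_conj, ← Complex.exp_add]
  congr 2
  simp
  ring

theorem mul_mul_conjTranspose_apply_self {M n : ℕ} {W : Matrix (Fin M) (Fin n) ℂ}
    (hW : ∀ m n, W m n =
      Complex.exp (-Complex.I * ((m : ℕ) : ℂ) * ((n : ℕ) : ℂ) * (2 * Real.pi / M)))
    (X : Matrix (Fin n) (Fin n) ℂ) (m : Fin M) :
    (W * X * Wᴴ) m m = expForm X (2 * Real.pi * (m : ℕ) / M) := by
  have h : ∀ a, W m a = expVec n (2 * Real.pi * (m : ℕ) / M) a := by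
    intro a
    rw [hW, expVec]
    congr 1
    push_cast
    ring
  rw [Matrix.mul_assoc, Matrix.mul_apply, expForm]
  simp only [dotProduct, ← h, Matrix.mul_apply, mulVec, conjTranspose_apply, Pi.star_apply]

/-- Real-valued functions given by a trigonometric polynomial of degree at most `n`. -/
def IsTrigPoly (n : ℕ) (h : ℝ → ℝ) : Prop :=
  ∃ q : Fin (n + 1) → ℂ, (q 0).im = 0 ∧ ∀ φ, h φ = trigEval q φ

theorem IsTrigPoly.add {n : ℕ} {f g : ℝ → ℝ} (hf : IsTrigPoly n f) (hg : IsTrigPoly n g) :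
    IsTrigPoly n (fun φ => f φ + g φ) := by
  obtain ⟨q, hq, hfq⟩ := hf
  obtain ⟨r, hr, hgr⟩ := hg
  refine ⟨q + r, by simp [hq, hr], fun φ => ?_⟩
  simp only [hfq, hgr, trigEval, Pi.add_apply, add_mul, Finset.sum_add_distrib, Complex.add_re]
  ring

theorem isTrigPoly_zero (n : ℕ) : IsTrigPoly n (fun _ => 0) :=
  ⟨0, by simp, fun φ => by simp [trigEval]⟩

theorem IsTrigPoly.sum {n : ℕ} {ι : Type*} (s : Finset ι) {f : ι → ℝ → ℝ}
    (hf : ∀ i ∈ s, IsTrigPoly n (f i)) : IsTrigPoly n (fun φ => ∑ i ∈ s, f i φ) := by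
  classical
  induction s using Finset.induction_on with
  | empty => simpa using isTrigPoly_zero n
  | insert a s ha ih =>
    simp only [Finset.sum_insert ha]
    exact (hf a (by simp)).add (ih fun i hi => hf i (by simp [hi]))

theorem isTrigPoly_re_mul_exp_nat {n l : ℕ} (hl : l ≤ n) (c : ℂ) :
    IsTrigPoly n
      (fun φ => (c * Complex.exp (-Complex.I * (l : ℂ) * (φ : ℂ))).re) := by
  rcases Nat.eq_zero_or_pos l with rfl | hpos
  · refine ⟨Pi.single 0 (c.re : ℂ), by simp, fun φ => ?_⟩
    rw [trigEval, Finset.sum_eq_zero]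
    · simp
    · intro k hk
      have : k ≠ 0 := by rintro rfl; simp at hk
      simp [this]
  · have h0 : (⟨l, by omega⟩ : Fin (n + 1)) ≠ 0 := by simp [Fin.ext_iff]; omega
    refine ⟨Pi.single ⟨l, by omega⟩ (c / 2), by simp [h0.symm], fun φ => ?_⟩
    rw [trigEval, Finset.sum_eq_single ⟨l, by omega⟩]
    · simp only [Pi.single_eq_same, ne_eq, h0.symm, not_false_eq_true, Pi.single_eq_of_ne,
        Complex.zero_re, zero_add]
      rw [div_mul_eq_mul_div, ← Complex.ofReal_ofNat, Complex.div_ofReal_re]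
      ring
    · intro k _ hk
      simp [hk]
    · intro h
      simp at h
      omega

theorem isTrigPoly_re_mul_exp {n : ℕ} {l : ℤ} (hl : |l| ≤ n) (c : ℂ) :
    IsTrigPoly n (fun φ => (c * Complex.exp (-Complex.I * (l : ℂ) * (φ : ℂ))).re) := by
  obtain ⟨k, rfl | rfl⟩ := l.eq_nat_or_neg
  · simpa using isTrigPoly_re_mul_exp_nat (n := n) (l := k) (by simpa using hl) c
  · convert isTrigPoly_re_mul_exp_nat (n := n) (l := k) (by simpa using hl) (star c) using 2 with φ
    rw [← Complex.conj_re, map_mul, ← Complex.exp_conj]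
    simp

theorem isTrigPoly_cos_sub_mul {n : ℕ} {l : ℤ} (hl : |l| + 1 ≤ n) (c : ℂ) (θ b : ℝ) :
    IsTrigPoly n (fun φ => (Real.cos (φ - θ) - b) *
      (c * Complex.exp (-Complex.I * (l : ℂ) * (φ : ℂ))).re) := by
  have hl' := abs_le.1 (show |l| ≤ (n : ℤ) - 1 by linarith)
  have h1 := isTrigPoly_re_mul_exp (n := n) (l := l + 1) (abs_le.2 ⟨by linarith, by linarith⟩)
    (c * Complex.exp (Complex.I * θ) / 2)
  have h2 := isTrigPoly_re_mul_exp (n := n) (l := l - 1) (abs_le.2 ⟨by linarith, by linarith⟩)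
    (c * Complex.exp (-Complex.I * θ) / 2)
  have h3 := isTrigPoly_re_mul_exp (n := n) (l := l) (abs_le.2 ⟨by linarith, by linarith⟩)
    (-b * c)
  convert (h1.add h2).add h3 using 2 with φ
  rw [← Complex.re_ofReal_mul, ← Complex.add_re, ← Complex.add_re]
  congr 1
  push_cast
  rw [Complex.cos]
  have e1 : Complex.exp (-Complex.I * (l + 1) * φ) =
      Complex.exp (-Complex.I * l * φ) * Complex.exp (-Complex.I * φ) := by
    rw [← Complex.exp_add]; ring_nf
  have e2 : Complex.exp (-Complex.I * (l - 1) * φ) =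
      Complex.exp (-Complex.I * l * φ) * Complex.exp (Complex.I * φ) := by
    rw [← Complex.exp_add]; ring_nf
  have e3 : Complex.exp ((φ - θ) * Complex.I) =
      Complex.exp (Complex.I * φ) * Complex.exp (-Complex.I * θ) := by
    rw [← Complex.exp_add]; ring_nf
  have e4 : Complex.exp (-(φ - θ) * Complex.I) =
      Complex.exp (-Complex.I * φ) * Complex.exp (Complex.I * θ) := by
    rw [← Complex.exp_add]; ring_nf
  rw [e1, e2, e3, e4]
  ring

theorem isTrigPoly_re_expForm {n : ℕ} (X : Matrix (Fin (n + 1)) (Fin (n + 1)) ℂ) :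
    IsTrigPoly n (fun φ => (expForm X φ).re) := by
  simp only [expForm_eq_sum, Complex.re_sum]
  refine IsTrigPoly.sum _ fun a _ => IsTrigPoly.sum _ fun b _ => isTrigPoly_re_mul_exp ?_ _
  rw [abs_le]
  omega

theorem isTrigPoly_cos_sub_mul_re_expForm {n : ℕ} (X : Matrix (Fin n) (Fin n) ℂ) (θ b : ℝ) :
    IsTrigPoly n (fun φ => (Real.cos (φ - θ) - b) * (expForm X φ).re) := by
  simp only [expForm_eq_sum, Complex.re_sum, Finset.mul_sum]
  refine IsTrigPoly.sum _ fun a _ => IsTrigPoly.sum _ fun b _ => isTrigPoly_cos_sub_mul ?_ _ _ _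
  have : |((a : ℕ) : ℤ) - (b : ℕ)| ≤ (n : ℤ) - 1 := by
    rw [abs_le]
    omega
  linarith

theorem sum_exp_int_mul {M : ℕ} {l : ℤ} (hl : |l| < M) :
    ∑ m : Fin M, Complex.exp (Complex.I * (l : ℂ) * (2 * Real.pi * (m : ℕ) / M)) =
      if l = 0 then (M : ℂ) else 0 := by
  have hM : M ≠ 0 := by rintro rfl; simp at hl; exact absurd hl (abs_nonneg l).not_gt
  split_ifs with h
  · simp [h]
  have hζ := Complex.isPrimitiveRoot_exp M hM
  set ζ := Complex.exp (2 * Real.pi * Complex.I / M) with hζd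
  have hne : ζ ^ l ≠ 1 := by
    rw [Ne, hζ.zpow_eq_one_iff_dvd]
    exact fun hd => h (Int.eq_zero_of_abs_lt_dvd hd hl)
  have hterm : ∀ m : Fin M, Complex.exp (Complex.I * (l : ℂ) * (2 * Real.pi * (m : ℕ) / M)) =
      (ζ ^ l) ^ (m : ℕ) := by
    intro m
    rw [hζd, ← Complex.exp_int_mul, ← Complex.exp_nat_mul]
    congr 1
    ring
  simp only [hterm]
  rw [Fin.sum_univ_eq_sum_range (fun m => (ζ ^ l) ^ m) M, geom_sum_eq hne, ← zpow_natCast,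
    ← _root_.zpow_mul, mul_comm l, _root_.zpow_mul, zpow_natCast, hζ.pow_eq_one]
  simp

theorem ofReal_trigEval {n : ℕ} {q : Fin (n + 1) → ℂ} (hq : (q 0).im = 0) (φ : ℝ) :
    (trigEval q φ : ℂ) = ∑ k, q k * Complex.exp (-Complex.I * ((k : ℕ) : ℂ) * (φ : ℂ)) +
      ∑ k ∈ Finset.univ.filter (fun k : Fin (n + 1) => (k : ℕ) ≠ 0),
        star (q k) * Complex.exp (Complex.I * ((k : ℕ) : ℂ) * (φ : ℂ)) := by
  have h0 : ((q 0).re : ℂ) = q 0 := Complex.ext rfl (by simp [hq])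
  have hs : ∑ k, q k * Complex.exp (-Complex.I * ((k : ℕ) : ℂ) * (φ : ℂ)) =
      q 0 + ∑ k ∈ Finset.univ.filter (fun k : Fin (n + 1) => (k : ℕ) ≠ 0),
        q k * Complex.exp (-Complex.I * ((k : ℕ) : ℂ) * (φ : ℂ)) := by
    rw [← Finset.sum_filter_add_sum_filter_not _ (fun k : Fin (n + 1) => (k : ℕ) ≠ 0), add_comm]
    congr 1
    rw [Finset.sum_eq_single 0]
    · simp
    · intro b hb hb0
      simp at hb
      exact absurd hb hb0
    · intro h
      simp at h
  rw [hs, trigEval, Complex.ofReal_add, h0, Complex.ofReal_mul, Complex.re_eq_add_conj, map_sum,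
    add_assoc]
  congr 1
  have : ∀ k : Fin (n + 1),
      (starRingEnd ℂ) (q k * Complex.exp (-Complex.I * ((k : ℕ) : ℂ) * (φ : ℂ))) =
      star (q k) * Complex.exp (Complex.I * ((k : ℕ) : ℂ) * (φ : ℂ)) := by
    intro k
    rw [map_mul, ← Complex.exp_conj]
    simp
  simp only [this]
  push_cast
  ring

/-- Sampling a trigonometric polynomial on the DFT grid and applying `Wᴴ` recovers `M • q`. -/
theorem conjTranspose_mulVec_trigEval {n M : ℕ} (hM : 2 * n + 1 ≤ M)
    {W : Matrix (Fin M) (Fin (n + 1)) ℂ}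
    (hW : ∀ m n, W m n =
      Complex.exp (-Complex.I * ((m : ℕ) : ℂ) * ((n : ℕ) : ℂ) * (2 * Real.pi / M)))
    {q : Fin (n + 1) → ℂ} (hq : (q 0).im = 0) :
    Wᴴ *ᵥ (fun m : Fin M => (trigEval q (2 * Real.pi * (m : ℕ) / M) : ℂ)) = (M : ℂ) • q := by
  ext j
  have hstar : ∀ m : Fin M, Wᴴ j m =
      Complex.exp (Complex.I * ((j : ℕ) : ℂ) * (2 * Real.pi * (m : ℕ) / M)) := by
    intro m
    rw [conjTranspose_apply, hW, Complex.star_def, ← Complex.exp_conj]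
    congr 1
    simp [Complex.conj_ofNat]
    ring
  have e1 : ∀ (m : Fin M) (k : Fin (n + 1)),
      Complex.exp (Complex.I * ((j : ℕ) : ℂ) * (2 * Real.pi * (m : ℕ) / M)) * (q k *
        Complex.exp (-Complex.I * ((k : ℕ) : ℂ) * ((2 * Real.pi * (m : ℕ) / M : ℝ) : ℂ))) =
      q k * Complex.exp (Complex.I * (((j : ℕ) - (k : ℕ) : ℤ) : ℂ) *
        (2 * Real.pi * (m : ℕ) / M)) := by
    intro m k
    rw [mul_left_comm, ← Complex.exp_add]
    congr 2
    push_cast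
    ring
  have e2 : ∀ (m : Fin M) (k : Fin (n + 1)),
      Complex.exp (Complex.I * ((j : ℕ) : ℂ) * (2 * Real.pi * (m : ℕ) / M)) * (star (q k) *
        Complex.exp (Complex.I * ((k : ℕ) : ℂ) * ((2 * Real.pi * (m : ℕ) / M : ℝ) : ℂ))) =
      star (q k) * Complex.exp (Complex.I * (((j : ℕ) + (k : ℕ) : ℤ) : ℂ) *
        (2 * Real.pi * (m : ℕ) / M)) := by
    intro m k
    rw [mul_left_comm, ← Complex.exp_add]
    congr 2
    push_cast
    ring
  simp only [mulVec, dotProduct, hstar, ofReal_trigEval hq, mul_add, Finset.mul_sum, e1, e2,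
    Finset.sum_add_distrib, Pi.smul_apply, smul_eq_mul]
  rw [Finset.sum_comm, Finset.sum_comm (s := Finset.univ (α := Fin M))]
  simp only [← Finset.mul_sum]
  have hj := j.2
  rw [Finset.sum_eq_single j, Finset.sum_eq_zero (s := Finset.univ.filter _),
    sum_exp_int_mul (by simp; omega)]
  · simp [mul_comm]
  · intro k hk
    have hk' := k.2
    simp only [Finset.mem_filter, Finset.mem_univ, true_and] at hk
    rw [sum_exp_int_mul (by rw [abs_lt]; omega), if_neg (by omega), mul_zero]
  · intro k _ hk
    have hk' := k.2
    have : (k : ℕ) ≠ j := fun h => hk (Fin.ext h)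
    rw [sum_exp_int_mul (by rw [abs_lt]; omega), if_neg (by omega), mul_zero]
  · simp

end TrigPolynomial

/-- Functions of the form a Hermitian square plus `cos (φ - θ) - cos β` times another. -/
def IsArcSum (n : ℕ) (θ β : ℝ) (h : ℝ → ℝ) : Prop :=
  ∃ (X₁ : Matrix (Fin (n + 1)) (Fin (n + 1)) ℂ) (X₂ : Matrix (Fin n) (Fin n) ℂ),
    X₁.PosSemidef ∧ X₂.PosSemidef ∧ ∀ φ : ℝ,
      h φ = (expForm X₁ φ).re + (Real.cos (φ - θ) - Real.cos β) * (expForm X₂ φ).re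

/-- The polynomial `P`, transported to the circle by `t = tan ((φ - θ) / 2)` and multiplied by
`cos ((φ - θ) / 2) ^ (2 * n)`, is an arc sum. -/
def IsArcRealizable (n : ℕ) (θ β : ℝ) (P : Polynomial ℝ) : Prop :=
  ∃ h, IsArcSum n θ β h ∧ ∀ φ : ℝ, Real.cos ((φ - θ) / 2) ≠ 0 →
    h φ = Real.cos ((φ - θ) / 2) ^ (2 * n) * P.eval (Real.tan ((φ - θ) / 2))

section Realization

open Polynomial

theorem IsArcSum.add {n : ℕ} {θ β : ℝ} {f g : ℝ → ℝ} (hf : IsArcSum n θ β f)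
    (hg : IsArcSum n θ β g) : IsArcSum n θ β (fun φ => f φ + g φ) := by
  obtain ⟨X₁, X₂, h1, h2, hf⟩ := hf
  obtain ⟨Y₁, Y₂, k1, k2, hg⟩ := hg
  refine ⟨X₁ + Y₁, X₂ + Y₂, h1.add k1, h2.add k2, fun φ => ?_⟩
  simp only [hf, hg, expForm_add, Complex.add_re]
  ring

theorem IsArcSum.const_mul {n : ℕ} {θ β c : ℝ} (hc : 0 ≤ c) {f : ℝ → ℝ}
    (hf : IsArcSum n θ β f) : IsArcSum n θ β (fun φ => c * f φ) := by
  obtain ⟨X₁, X₂, h1, h2, hf⟩ := hf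
  refine ⟨c • X₁, c • X₂, h1.smul hc, h2.smul hc, fun φ => ?_⟩
  simp only [hf, expForm_smul, Complex.re_ofReal_mul]
  ring

theorem IsArcRealizable.add {n : ℕ} {θ β : ℝ} {P Q : ℝ[X]} (hP : IsArcRealizable n θ β P)
    (hQ : IsArcRealizable n θ β Q) : IsArcRealizable n θ β (P + Q) := by
  obtain ⟨f, hf, hfP⟩ := hP
  obtain ⟨g, hg, hgQ⟩ := hQ
  refine ⟨_, hf.add hg, fun φ hφ => ?_⟩
  rw [hfP φ hφ, hgQ φ hφ, eval_add]
  ring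

theorem IsArcRealizable.C_mul {n : ℕ} {θ β c : ℝ} (hc : 0 ≤ c) {P : ℝ[X]}
    (hP : IsArcRealizable n θ β P) : IsArcRealizable n θ β (C c * P) := by
  obtain ⟨f, hf, hfP⟩ := hP
  refine ⟨_, hf.const_mul hc, fun φ hφ => ?_⟩
  rw [hfP φ hφ, eval_mul, eval_C]
  ring

theorem exists_expVec_dotProduct_eq {n : ℕ} (θ : ℝ) {f : ℝ[X]} (hf : f.natDegree ≤ n) :
    ∃ x : Fin (n + 1) → ℂ, ∀ φ : ℝ, Real.cos ((φ - θ) / 2) ≠ 0 →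
      ‖expVec (n + 1) φ ⬝ᵥ x‖ ^ 2 =
        Real.cos ((φ - θ) / 2) ^ (2 * n) * f.eval (Real.tan ((φ - θ) / 2)) ^ 2 := by
  set w := Complex.exp (Complex.I * θ) with hw
  set S : ℂ[X] := C (-Complex.I / 2) * (1 - C w * X) with hS
  set K : ℂ[X] := C (1 / 2) * (1 + C w * X) with hK
  set G : ℂ[X] := ∑ j ∈ Finset.range (n + 1), C (f.coeff j : ℂ) * (S ^ j * K ^ (n - j)) with hG
  have hSd : S.natDegree ≤ 1 := by rw [hS]; compute_degree
  have hKd : K.natDegree ≤ 1 := by rw [hK]; compute_degree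
  have hGd : G.natDegree < n + 1 := by
    refine Nat.lt_succ_of_le (natDegree_sum_le_of_forall_le _ _ fun j hj => ?_)
    have h1 := natDegree_pow_le_of_le j hSd
    have h2 := natDegree_pow_le_of_le (n - j) hKd
    have h3 := (natDegree_C_mul_le (f.coeff j : ℂ) _).trans (natDegree_mul_le_of_le h1 h2)
    have := Finset.mem_range.1 hj
    omega
  refine ⟨fun a => G.coeff a, fun φ hφ => ?_⟩
  set y := (φ - θ) / 2 with hy
  set e := Complex.exp (-Complex.I * y) with he
  have hdot : expVec (n + 1) φ ⬝ᵥ (fun a : Fin (n + 1) => G.coeff a) =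
      G.eval (Complex.exp (-Complex.I * φ)) := by
    rw [eval_eq_sum_range' hGd, dotProduct,
      ← Fin.sum_univ_eq_sum_range (fun a => G.coeff a * Complex.exp (-Complex.I * φ) ^ a)]
    refine Finset.sum_congr rfl fun a _ => ?_
    rw [expVec, ← Complex.exp_nat_mul, mul_comm]
    congr 2
    ring
  have hwz : w * Complex.exp (-Complex.I * φ) = e * e := by
    rw [hw, he, ← Complex.exp_add, ← Complex.exp_add]
    congr 1
    rw [hy]
    push_cast
    ring
  have hee : e * Complex.exp (Complex.I * y) = 1 := by
    rw [he, ← Complex.exp_add]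
    simp
  have hSe : S.eval (Complex.exp (-Complex.I * φ)) = e * (Real.sin y : ℂ) := by
    simp only [hS, eval_mul, eval_C, eval_sub, eval_one, eval_X, hwz]
    rw [Complex.ofReal_sin, Complex.sin, ← mul_comm Complex.I (y : ℂ),
      show -(y : ℂ) * Complex.I = -Complex.I * y by ring, ← he, ← hee]
    ring
  have hKe : K.eval (Complex.exp (-Complex.I * φ)) = e * (Real.cos y : ℂ) := by
    simp only [hK, eval_mul, eval_C, eval_add, eval_one, eval_X, hwz]
    rw [Complex.ofReal_cos, Complex.cos, ← mul_comm Complex.I (y : ℂ),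
      show -(y : ℂ) * Complex.I = -Complex.I * y by ring, ← he]
    linear_combination (-1 / 2) * hee
  have hGe : G.eval (Complex.exp (-Complex.I * φ)) =
      e ^ n * ((Real.cos y ^ n * f.eval (Real.tan y) : ℝ) : ℂ) := by
    rw [eval_eq_sum_range' (Nat.lt_succ_of_le hf), hG, eval_finsetSum, Finset.mul_sum,
      Complex.ofReal_sum, Finset.mul_sum]
    refine Finset.sum_congr rfl fun j hj => ?_
    have hjn : n = (n - j) + j := by have := Finset.mem_range.1 hj; omega
    have hsin : Real.sin y = Real.tan y * Real.cos y := (Real.tan_mul_cos hφ).symm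
    simp only [eval_mul, eval_pow, eval_C, hSe, hKe, hsin]
    generalize n - j = l at hjn
    subst hjn
    push_cast
    ring
  have hne : ‖e‖ = 1 := by
    rw [he, show -Complex.I * (y : ℂ) = ((-y : ℝ) : ℂ) * Complex.I by push_cast; ring]
    exact Complex.norm_exp_ofReal_mul_I _
  rw [hdot, hGe, norm_mul, norm_pow, hne, one_pow, one_mul, Complex.norm_real, Real.norm_eq_abs,
    sq_abs]
  ring

theorem isArcRealizable_sq {n : ℕ} (θ β : ℝ) {f : ℝ[X]} (hf : f.natDegree ≤ n) :
    IsArcRealizable n θ β (f ^ 2) := by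
  obtain ⟨x, hx⟩ := exists_expVec_dotProduct_eq θ hf
  refine ⟨_, ⟨vecMulVec x (star x), 0, posSemidef_vecMulVec_self_star x, PosSemidef.zero,
    fun φ => rfl⟩, fun φ hφ => ?_⟩
  rw [expForm_vecMulVec, Complex.ofReal_re, hx φ hφ]
  simp [expForm]

theorem cos_sub_cos_eq_tan {x b : ℝ} (hx : Real.cos (x / 2) ≠ 0) (hb : Real.cos (b / 2) ≠ 0) :
    Real.cos x - Real.cos b = 2 * Real.cos (b / 2) ^ 2 * Real.cos (x / 2) ^ 2 *
      (Real.tan (b / 2) ^ 2 - Real.tan (x / 2) ^ 2) := by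
  have h1 : Real.cos x = 2 * Real.cos (x / 2) ^ 2 - 1 := by rw [← Real.cos_two_mul]; ring_nf
  have h2 : Real.cos b = 2 * Real.cos (b / 2) ^ 2 - 1 := by rw [← Real.cos_two_mul]; ring_nf
  rw [h1, h2, Real.tan_eq_sin_div_cos, Real.tan_eq_sin_div_cos, div_pow, div_pow, Real.sin_sq,
    Real.sin_sq]
  field_simp
  ring

theorem isArcRealizable_sq_mul {n : ℕ} (θ : ℝ) {β : ℝ} (hβ : Real.cos (β / 2) ≠ 0) {f : ℝ[X]}
    (hf : f.natDegree ≤ n) : IsArcRealizable (n + 1) θ β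
      (f ^ 2 * (C (Real.tan (β / 2)) - X) * (C (Real.tan (β / 2)) + X)) := by
  obtain ⟨x, hx⟩ := exists_expVec_dotProduct_eq θ hf
  refine ⟨_, ⟨0, (2 * Real.cos (β / 2) ^ 2)⁻¹ • vecMulVec x (star x), PosSemidef.zero,
    (posSemidef_vecMulVec_self_star x).smul (by positivity), fun φ => rfl⟩, fun φ hφ => ?_⟩
  rw [expForm_smul, expForm_vecMulVec, Complex.re_ofReal_mul, Complex.ofReal_re, hx φ hφ,
    cos_sub_cos_eq_tan hφ hβ]
  simp only [expForm, zero_mulVec, dotProduct_zero, Complex.zero_re, eval_mul, eval_pow, eval_sub,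
    eval_add, eval_C, eval_X]
  field_simp
  ring

theorem isArcRealizable_of_mem_intervalCone {n : ℕ} (θ : ℝ) {β : ℝ} (hβ : β ∈ Set.Ioo 0 Real.pi)
    {P : ℝ[X]} (hP : P ∈ intervalCone (Real.tan (β / 2)) (2 * (n + 1))) :
    IsArcRealizable (n + 1) θ β P := by
  have hcos : Real.cos (β / 2) ≠ 0 :=
    (Real.cos_pos_of_mem_Ioo ⟨by linarith [hβ.1, Real.pi_pos], by linarith [hβ.2]⟩).ne'
  have hT : 0 < Real.tan (β / 2) :=
    Real.tan_pos_of_pos_of_lt_pi_div_two (by linarith [hβ.1]) (by linarith [hβ.2])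
  induction hP using AddSubmonoid.closure_induction with
  | zero => simpa using isArcRealizable_sq (n := n + 1) θ β (f := 0) (by simp)
  | add a b _ _ ha hb => exact ha.add hb
  | mem a ha =>
    obtain ⟨f, i, j, hd, rfl⟩ := ha
    have hsq := fun g => isArcRealizable_sq_mul (n := n) θ hcos (f := g)
    set T := Real.tan (β / 2)
    have hdeg : ∀ i j, (f * (C T - X) ^ i * (C T + X) ^ j).natDegree ≤ f.natDegree + i + j := by
      intro i j
      have h1 : (C T - X : ℝ[X]).natDegree ≤ 1 := by compute_degree
      have h2 : (C T + X : ℝ[X]).natDegree ≤ 1 := by compute_degree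
      simpa using natDegree_mul_le_of_le (natDegree_mul_le_of_le le_rfl
        (natDegree_pow_le_of_le i h1)) (natDegree_pow_le_of_le j h2)
    have hC : C ((2 * T)⁻¹) * (2 * C T) = (1 : ℝ[X]) := by
      rw [← C_ofNat, ← C_mul, ← C_mul, inv_mul_cancel₀ (by positivity), C_1]
    obtain ⟨i, rfl | rfl⟩ := i.even_or_odd' <;> obtain ⟨j, rfl | rfl⟩ := j.even_or_odd'
    all_goals
      have hij := hdeg i j
      have hij1 := hdeg (i + 1) j
      have hij2 := hdeg i (j + 1)
    · convert isArcRealizable_sq θ β (n := n + 1) (hij.trans (by omega)) using 1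
      ring
    · convert ((isArcRealizable_sq θ β (n := n + 1) (hij2.trans (by omega))).add
        (hsq _ (hij.trans (by omega)))).C_mul (c := (2 * T)⁻¹) (by positivity) using 1
      linear_combination (-f ^ 2 * (C T - X) ^ (2 * i) * (C T + X) ^ (2 * j + 1)) * hC
    · convert ((isArcRealizable_sq θ β (n := n + 1) (hij1.trans (by omega))).add
        (hsq _ (hij.trans (by omega)))).C_mul (c := (2 * T)⁻¹) (by positivity) using 1
      linear_combination (-f ^ 2 * (C T - X) ^ (2 * i + 1) * (C T + X) ^ (2 * j)) * hC
    · convert hsq _ (hij.trans (by omega)) using 1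
      ring

theorem exists_real_polynomial_re_eval (Q : ℂ[X]) {m : ℕ} (hQ : Q.natDegree ≤ m) :
    ∃ P : ℝ[X], P.natDegree ≤ m ∧ ∀ t : ℝ, P.eval t = (Q.eval (t : ℂ)).re := by
  refine ⟨∑ j ∈ Finset.range (m + 1), C (Q.coeff j).re * X ^ j,
    natDegree_sum_le_of_forall_le _ _ fun j hj => ?_, fun t => ?_⟩
  · exact (natDegree_C_mul_X_pow_le _ _).trans (Nat.lt_succ_iff.1 (Finset.mem_range.1 hj))
  · rw [eval_eq_sum_range' (Nat.lt_succ_of_le hQ), eval_finsetSum, Complex.re_sum]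
    refine Finset.sum_congr rfl fun j _ => ?_
    rw [← Complex.ofReal_pow, Complex.re_mul_ofReal]
    simp

theorem exists_polynomial_trigEval {n : ℕ} (q : Fin (n + 1) → ℂ) (θ : ℝ) :
    ∃ P : ℝ[X], P.natDegree ≤ 2 * n ∧ ∀ φ : ℝ, Real.cos ((φ - θ) / 2) ≠ 0 →
      trigEval q φ =
        Real.cos ((φ - θ) / 2) ^ (2 * n) * P.eval (Real.tan ((φ - θ) / 2)) := by
  set A : ℂ[X] := 1 - C Complex.I * X with hA
  set B : ℂ[X] := 1 + C Complex.I * X with hB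
  have hAd : A.natDegree ≤ 1 := by rw [hA]; compute_degree
  have hBd : B.natDegree ≤ 1 := by rw [hB]; compute_degree
  have hterm : ∀ (c : ℂ) (k : Fin (n + 1)),
      (C c * (A ^ (n + k) * B ^ (n - k))).natDegree ≤ 2 * n := by
    intro c k
    have := (natDegree_C_mul_le c _).trans (natDegree_mul_le_of_le
      (natDegree_pow_le_of_le (n + k) hAd) (natDegree_pow_le_of_le (n - k) hBd))
    have := k.2
    omega
  let c : Fin (n + 1) → ℂ := fun k => q k * Complex.exp (-Complex.I * (k : ℕ) * θ)
  set Q : ℂ[X] := C (c 0) * (A ^ (n + (0 : Fin (n + 1))) * B ^ (n - (0 : Fin (n + 1)))) +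
    C 2 * ∑ k ∈ Finset.univ.filter (fun k : Fin (n + 1) => (k : ℕ) ≠ 0),
      C (c k) * (A ^ (n + k) * B ^ (n - k)) with hQ
  have hQd : Q.natDegree ≤ 2 * n := natDegree_add_le_of_degree_le (hterm _ _)
    ((natDegree_C_mul_le _ _).trans (natDegree_sum_le_of_forall_le _ _ fun k _ => hterm _ _))
  obtain ⟨P, hPd, hP⟩ := exists_real_polynomial_re_eval Q hQd
  refine ⟨P, hPd, fun φ hφ => ?_⟩
  set y := (φ - θ) / 2 with hy
  have htan : (Real.cos y : ℂ) * (Real.tan y : ℂ) = Real.sin y := by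
    exact_mod_cast (mul_comm _ _).trans (Real.tan_mul_cos hφ)
  have hAe : (Real.cos y : ℂ) * A.eval (Real.tan y : ℂ) = Complex.exp (-Complex.I * y) := by
    rw [show -Complex.I * (y : ℂ) = ((-y : ℝ) : ℂ) * Complex.I by push_cast; ring,
      Complex.exp_mul_I, ← Complex.ofReal_cos, ← Complex.ofReal_sin, Real.cos_neg, Real.sin_neg]
    simp only [hA, eval_sub, eval_one, eval_mul, eval_C, eval_X, Complex.ofReal_neg]
    linear_combination -Complex.I * htan
  have hBe : (Real.cos y : ℂ) * B.eval (Real.tan y : ℂ) = Complex.exp (Complex.I * y) := by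
    rw [mul_comm Complex.I, Complex.exp_mul_I, ← Complex.ofReal_cos, ← Complex.ofReal_sin]
    simp only [hB, eval_add, eval_one, eval_mul, eval_C, eval_X]
    linear_combination Complex.I * htan
  have hke : ∀ k : Fin (n + 1), (Real.cos y : ℂ) ^ (2 * n) *
      (C (c k) * (A ^ (n + k) * B ^ (n - k))).eval (Real.tan y : ℂ) =
      q k * Complex.exp (-Complex.I * (k : ℕ) * φ) := by
    intro k
    obtain ⟨l, hl⟩ := Nat.exists_eq_add_of_le (Nat.lt_succ_iff.1 k.2)
    have hsplit : (2 * n) = (n + k) + (n - k) := by omega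
    rw [hsplit, pow_add, eval_mul, eval_C, eval_mul, eval_pow, eval_pow,
      show ∀ a b c d e : ℂ, a * b * (c * (d * e)) = c * ((a * d) * (b * e)) by intros; ring,
      ← mul_pow, ← mul_pow, hAe, hBe, ← Complex.exp_nat_mul, ← Complex.exp_nat_mul,
      ← Complex.exp_add, mul_assoc, ← Complex.exp_add]
    congr 2
    rw [show n - (k : ℕ) = l by omega]
    have hn : (n : ℂ) = (k : ℕ) + l := by exact_mod_cast hl
    push_cast
    rw [hn, hy]
    push_cast
    ring
  rw [hP, ← Complex.re_ofReal_mul, Complex.ofReal_pow, hQ, eval_add, mul_add, hke, eval_mul,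
    eval_C, mul_left_comm, eval_finsetSum, Finset.mul_sum]
  simp only [hke]
  simp [trigEval]

theorem trigEval_eq_isArcSum {n : ℕ} {q : Fin (n + 2) → ℂ} {θ β : ℝ}
    (hβ : β ∈ Set.Ioo 0 Real.pi)
    (h : ∀ φ ∈ Set.Icc (θ - β) (θ + β), 0 ≤ trigEval q φ) :
    IsArcSum (n + 1) θ β (trigEval q) := by
  obtain ⟨P, hPd, hP⟩ := exists_polynomial_trigEval q θ
  have hT : 0 < Real.tan (β / 2) :=
    Real.tan_pos_of_pos_of_lt_pi_div_two (by linarith [hβ.1]) (by linarith [hβ.2])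
  have harctan : Real.arctan (Real.tan (β / 2)) = β / 2 :=
    Real.arctan_tan (by linarith [hβ.1, Real.pi_pos]) (by linarith [hβ.2])
  have hnonneg : ∀ t ∈ Set.Icc (-Real.tan (β / 2)) (Real.tan (β / 2)), 0 ≤ P.eval t := by
    intro t ht
    have h1 := Real.arctan_mono ht.1
    have h2 := Real.arctan_mono ht.2
    rw [Real.arctan_neg, harctan] at h1
    rw [harctan] at h2
    have hy : (θ + 2 * Real.arctan t - θ) / 2 = Real.arctan t := by ring
    have hp := h (θ + 2 * Real.arctan t) ⟨by linarith, by linarith⟩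
    have hc := Real.cos_arctan_pos t
    rw [hP _ (by rw [hy]; exact hc.ne'), hy, Real.tan_arctan] at hp
    exact nonneg_of_mul_nonneg_right hp (by positivity)
  obtain ⟨g, hg, hgP⟩ := isArcRealizable_of_mem_intervalCone θ hβ
    (intervalCone_mono _ hPd (mem_intervalCone_of_nonneg hT P hnonneg))
  have hdense : Dense {φ : ℝ | Real.cos ((φ - θ) / 2) ≠ 0} := by
    have hc : {φ : ℝ | Real.cos ((φ - θ) / 2) = 0}.Countable := by
      refine (Set.countable_range fun k : ℤ => θ + (2 * k + 1) * Real.pi).mono fun φ hφ => ?_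
      obtain ⟨k, hk⟩ := Real.cos_eq_zero_iff.1 hφ
      exact ⟨k, by linarith⟩
    exact hc.dense_compl ℝ
  have hgc : Continuous g := by
    obtain ⟨X₁, X₂, -, -, hX⟩ := hg
    rw [show g = _ from funext hX]
    simp only [expForm_eq_sum]
    fun_prop
  have hqc : Continuous (trigEval q) := by
    unfold trigEval
    fun_prop
  have : trigEval q = g := hqc.ext_on hdense hgc fun φ hφ => (hP φ hφ).trans (hgP φ hφ).symm
  rwa [this]

end Realization

/-- The SDP characterization, with the degree written as `n + 1`. -/
theorem trigEval_nonneg_on_arc_iff {n M : ℕ} (hM' : 2 * (n + 1) + 1 ≤ M)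
    {θ β : ℝ} (hβ : β ∈ Set.Ioo 0 Real.pi) {q : Fin (n + 2) → ℂ} (hq0 : (q 0).im = 0)
    {W : Matrix (Fin M) (Fin (n + 2)) ℂ}
    (hW : ∀ m n, W m n =
      Complex.exp (-Complex.I * ((m : ℕ) : ℂ) * ((n : ℕ) : ℂ) * (2 * Real.pi / M)))
    {W₁ : Matrix (Fin M) (Fin (n + 1)) ℂ}
    (hW₁ : ∀ m n, W₁ m n =
      Complex.exp (-Complex.I * ((m : ℕ) : ℂ) * ((n : ℕ) : ℂ) * (2 * Real.pi / M)))
    {d : Fin M → ℝ}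
    (hd : ∀ k : Fin M, d k = Real.cos (2 * Real.pi * (k : ℕ) / M - θ) - Real.cos β) :
    (∀ φ ∈ Set.Icc (θ - β) (θ + β), 0 ≤ trigEval q φ) ↔
      ∃ (X₁ : Matrix (Fin (n + 2)) (Fin (n + 2)) ℂ) (X₂ : Matrix (Fin (n + 1)) (Fin (n + 1)) ℂ),
        X₁.PosSemidef ∧ X₂.PosSemidef ∧
        q = Wᴴ *ᵥ (fun m : Fin M =>
          (W * X₁ * Wᴴ) m m + (d m : ℂ) * ((W₁ * X₂ * W₁ᴴ) m m)) := by
  have hM0 : (0 : ℝ) < M := by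
    have : 0 < M := by omega
    exact_mod_cast this
  have hM0' : (M : ℂ) ≠ 0 := by exact_mod_cast hM0.ne'
  have hsample : ∀ (X₁ : Matrix (Fin (n + 2)) (Fin (n + 2)) ℂ)
      (X₂ : Matrix (Fin (n + 1)) (Fin (n + 1)) ℂ), X₁.PosSemidef → X₂.PosSemidef →
      ∀ m : Fin M, (W * X₁ * Wᴴ) m m + (d m : ℂ) * ((W₁ * X₂ * W₁ᴴ) m m) =
        (((expForm X₁ (2 * Real.pi * (m : ℕ) / M)).re +
          (Real.cos (2 * Real.pi * (m : ℕ) / M - θ) - Real.cos β) *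
            (expForm X₂ (2 * Real.pi * (m : ℕ) / M)).re : ℝ) : ℂ) := by
    intro X₁ X₂ h1 h2 m
    rw [mul_mul_conjTranspose_apply_self hW, mul_mul_conjTranspose_apply_self hW₁, hd,
      Complex.ofReal_add, Complex.ofReal_mul, ofReal_re_expForm h1, ofReal_re_expForm h2]
  constructor
  · intro h
    obtain ⟨X₁, X₂, h1, h2, hX⟩ := trigEval_eq_isArcSum hβ h
    have hinv : (0 : ℝ) ≤ (M : ℝ)⁻¹ := by positivity
    refine ⟨(M : ℝ)⁻¹ • X₁, (M : ℝ)⁻¹ • X₂, h1.smul hinv, h2.smul hinv, ?_⟩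
    have hr : (fun m : Fin M => (W * ((M : ℝ)⁻¹ • X₁) * Wᴴ) m m +
        (d m : ℂ) * ((W₁ * ((M : ℝ)⁻¹ • X₂) * W₁ᴴ) m m)) =
        (M : ℂ)⁻¹ • fun m : Fin M => (trigEval q (2 * Real.pi * (m : ℕ) / M) : ℂ) := by
      ext m
      rw [hsample _ _ (h1.smul hinv) (h2.smul hinv), Pi.smul_apply, hX]
      simp only [expForm_smul, Complex.re_ofReal_mul]
      push_cast
      rw [smul_eq_mul]
      ring
    rw [hr, mulVec_smul, conjTranspose_mulVec_trigEval hM' hW hq0, smul_smul,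
      inv_mul_cancel₀ hM0', one_smul]
  · rintro ⟨X₁, X₂, h1, h2, hq⟩ φ hφ
    obtain ⟨r, hr0, hr⟩ := (isTrigPoly_re_expForm X₁).add
      (isTrigPoly_cos_sub_mul_re_expForm X₂ θ (Real.cos β))
    simp only [hsample _ _ h1 h2, hr] at hq
    rw [conjTranspose_mulVec_trigEval hM' hW hr0] at hq
    have hscale : trigEval q φ = M * trigEval r φ := by
      simp only [hq, trigEval, Pi.smul_apply, smul_eq_mul, mul_assoc, ← Finset.mul_sum,
        ← Complex.ofReal_natCast M, Complex.re_ofReal_mul]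
      ring
    rw [hscale, ← hr]
    have e1 := (Complex.nonneg_iff.1 (expForm_nonneg h1 φ)).1
    have e2 := (Complex.nonneg_iff.1 (expForm_nonneg h2 φ)).1
    have hcos : Real.cos β ≤ Real.cos (φ - θ) := by
      rw [← Real.cos_abs (φ - θ)]
      exact Real.cos_le_cos_of_nonneg_of_le_pi (abs_nonneg _) hβ.2.le
        (abs_le.2 ⟨by linarith [hφ.1], by linarith [hφ.2]⟩)
    have := mul_nonneg (sub_nonneg.2 hcos) e2
    positivity

/-- Characterization of trigonometric polynomials
`p(φ) = q₀ + 2·Re(Σ_{k=1}^{N−1} q_k e^{−ikφ})` (with `q₀` real) that are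
nonnegative on the interval `[θ−β, θ+β]`: this holds iff there exist positive
semidefinite Hermitian matrices `X₁ ∈ ℂ^{N×N}`, `X₂ ∈ ℂ^{(N−1)×(N−1)}` with
`q = Wᴴ[diag(W X₁ Wᴴ) + d ∘ diag(W₁ X₂ W₁ᴴ)]`, where `W`, `W₁` consist of the
first `N`, resp. `N−1`, columns of the `M×M` DFT matrix and
`d_k = cos(2πk/M − θ) − cos β`. -/
theorem nonneg_trig_poly_sdp_characterization
    (N M : ℕ) (hN : 2 ≤ N) (hM : 2 * N - 1 ≤ M)
    (θ β : ℝ) (hβ : β ∈ Set.Ioo 0 Real.pi)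
    (q : Fin N → ℂ) (hq0 : (q ⟨0, by omega⟩).im = 0)
    (W : Matrix (Fin M) (Fin N) ℂ)
    (hW : ∀ m n, W m n =
      Complex.exp (-Complex.I * ((m : ℕ) : ℂ) * ((n : ℕ) : ℂ) * (2 * Real.pi / M)))
    (W₁ : Matrix (Fin M) (Fin (N - 1)) ℂ)
    (hW₁ : ∀ m n, W₁ m n =
      Complex.exp (-Complex.I * ((m : ℕ) : ℂ) * ((n : ℕ) : ℂ) * (2 * Real.pi / M)))
    (d : Fin M → ℝ)
    (hd : ∀ k : Fin M, d k = Real.cos (2 * Real.pi * (k : ℕ) / M - θ) - Real.cos β) :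
    (∀ φ ∈ Set.Icc (θ - β) (θ + β),
        0 ≤ (q ⟨0, by omega⟩).re +
          2 * (∑ k ∈ Finset.univ.filter (fun k : Fin N => (k : ℕ) ≠ 0),
                q k * Complex.exp (-Complex.I * ((k : ℕ) : ℂ) * (φ : ℂ))).re)
      ↔ ∃ (X₁ : Matrix (Fin N) (Fin N) ℂ) (X₂ : Matrix (Fin (N - 1)) (Fin (N - 1)) ℂ),
          X₁.PosSemidef ∧ X₂.PosSemidef ∧
          q = Wᴴ *ᵥ (fun m : Fin M =>
                (W * X₁ * Wᴴ) m m + (d m : ℂ) * ((W₁ * X₂ * W₁ᴴ) m m)) := by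
  obtain ⟨n, rfl⟩ : ∃ n, N = n + 2 := ⟨N - 2, by omega⟩
  exact trigEval_nonneg_on_arc_iff (by omega) hβ hq0 hW hW₁ hd
end

section
/- Let N ≥ 2, M ≥ 2N−1, θ ∈ ℝ, β ∈ (0, π). Let C ∈ ℂ^{N×N} be Hermitian positive definite and z ∈ ℂ^N nonzero. Define A = C^{−1} z zᴴ C^{−1} and B = C^{−1}, and set x = (x_0, …, x_{N−1}), y = (y_0, …, y_{N−1}) with x_0 = tr(A), y_0 = tr(B), x_k = Σ_{m−n=−k} A_{nm}, y_k = Σ_{m−n=−k} B_{nm} for k = 1,…,N−1. For φ ∈ ℝ let p(φ) = (1, e^{iφ}, …, e^{i(N−1)φ})ᵀ and F(φ) = (p(φ)ᴴ A p(φ)) / (p(φ)ᴴ B p(φ)). Then the optimal value t* of the semidefinite program: minimize t over t ∈ ℝ≥0 and Hermitian positive semidefinite X₁ ∈ ℂ^{N×N}, X₂ ∈ ℂ^{(N−1)×(N−1)} subject to t·y − x = Wᴴ[ diag(W X₁ Wᴴ) + d ∘ diag(W₁ X₂ W₁ᴴ) ], equals max_{φ ∈ [θ−β, θ+β]} F(φ).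 -/
open Matrix ComplexOrder

section Lukacs

open Polynomial

/-- Sums of squares of real polynomials of degree less than `k`. -/
noncomputable def sosLT (k : ℕ) : AddSubmonoid ℝ[X] :=
  AddSubmonoid.closure {q | ∃ f : ℝ[X], f.degree < k ∧ q = f ^ 2}

lemma sq_mem_sosLT {k : ℕ} {f : ℝ[X]} (hf : f.degree < k) : f ^ 2 ∈ sosLT k :=
  AddSubmonoid.subset_closure ⟨f, hf, rfl⟩

lemma C_mem_sosLT (k : ℕ) {c : ℝ} (hc : 0 ≤ c) : C c ∈ sosLT (k + 1) := by
  have h : C c = (C (√c)) ^ 2 := by rw [← C_pow, Real.sq_sqrt hc]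
  rw [h]
  refine sq_mem_sosLT (degree_C_le.trans_lt ?_)
  exact_mod_cast Nat.succ_pos k

lemma sq_mul_mem_sosLT {k : ℕ} {l s : ℝ[X]} (hl : l.degree ≤ 1) (hs : s ∈ sosLT k) :
    l ^ 2 * s ∈ sosLT (k + 1) := by
  induction hs using AddSubmonoid.closure_induction with
  | mem q hq =>
    obtain ⟨f, hf, rfl⟩ := hq
    rw [← mul_pow]
    refine sq_mem_sosLT ?_
    by_cases h0 : f = 0
    · simp only [h0, mul_zero, degree_zero]
      exact WithBot.bot_lt_coe _
    rw [degree_eq_natDegree h0] at hf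
    have hf' : f.natDegree < k := by exact_mod_cast hf
    refine (degree_mul_le _ _).trans_lt ((add_le_add hl le_rfl).trans_lt ?_)
    rw [degree_eq_natDegree h0]
    have : 1 + f.natDegree < k + 1 := by omega
    exact_mod_cast this
  | zero => simp
  | add a b _ _ ha hb => rw [mul_add]; exact add_mem ha hb

lemma eval_nonneg_of_ne {b u₀ : ℝ} (hb : 0 < b) {Q : ℝ[X]}
    (h : ∀ u ∈ Set.Icc (-b) b, u ≠ u₀ → 0 ≤ Q.eval u) :
    ∀ u ∈ Set.Icc (-b) b, 0 ≤ Q.eval u := by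
  have h1 : Set.Ioo (-b) b ⊆ closure (Set.Ioo (-b) b ∩ {u₀}ᶜ) :=
    (dense_compl_singleton u₀).open_subset_closure_inter isOpen_Ioo
  have h2 : closure (Set.Ioo (-b) b ∩ {u₀}ᶜ) ⊆ {u | 0 ≤ Q.eval u} :=
    closure_minimal (fun u hu => h u (Set.Ioo_subset_Icc_self hu.1) hu.2)
      (isClosed_le continuous_const Q.continuous)
  intro u hu
  rw [← closure_Ioo (by linarith : (-b) ≠ b)] at hu
  exact h2 (closure_minimal h1 isClosed_closure hu)

lemma exists_sub_min {b : ℝ} (hb : 0 < b) {P : ℝ[X]} (h : ∀ u ∈ Set.Icc (-b) b, 0 ≤ P.eval u) :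
    ∃ c : ℝ, 0 ≤ c ∧ ∃ R : ℝ[X], P = C c + R ∧ R.natDegree ≤ P.natDegree ∧
      (∀ u ∈ Set.Icc (-b) b, 0 ≤ R.eval u) ∧ ∃ u₀ ∈ Set.Icc (-b) b, R.eval u₀ = 0 := by
  obtain ⟨u₀, hu₀, hmin⟩ := isCompact_Icc.exists_isMinOn (Set.nonempty_Icc.2 (by linarith : -b ≤ b))
    P.continuous.continuousOn
  refine ⟨P.eval u₀, h _ hu₀, P - C (P.eval u₀), by ring, natDegree_sub_C.le, ?_, u₀, hu₀, ?_⟩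
  · intro u hu
    have := isMinOn_iff.1 hmin u hu
    simpa using this
  · simp

lemma natDegree_le_of_mul {l Q : ℝ[X]} {d e : ℕ} (hl : l.natDegree = e) (hl0 : l ≠ 0)
    (h : (l * Q).natDegree ≤ d + e) : Q.natDegree ≤ d := by
  by_cases h0 : Q = 0
  · simp [h0]
  rw [natDegree_mul hl0 h0] at h
  omega

lemma exists_interior_factor {b u₀ : ℝ} (hu₀ : u₀ ∈ Set.Ioo (-b) b) {P : ℝ[X]}
    (h : ∀ u ∈ Set.Icc (-b) b, 0 ≤ P.eval u) (h0 : P.eval u₀ = 0) :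
    ∃ Q : ℝ[X], P = (X - C u₀) ^ 2 * Q ∧ ∀ u ∈ Set.Icc (-b) b, 0 ≤ Q.eval u := by
  have hb : 0 < b := by linarith [hu₀.1, hu₀.2]
  obtain ⟨P₁, rfl⟩ := dvd_iff_isRoot.2 h0
  have hmin : IsLocalMin (fun u => ((X - C u₀) * P₁).eval u) u₀ := by
    filter_upwards [isOpen_Ioo.mem_nhds hu₀] with u hu
    rw [h0]
    exact h u (Set.Ioo_subset_Icc_self hu)
  have hd := hmin.deriv_eq_zero
  rw [Polynomial.deriv] at hd
  have h1 : P₁.eval u₀ = 0 := by simpa using hd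
  obtain ⟨Q, rfl⟩ := dvd_iff_isRoot.2 h1
  refine ⟨Q, by ring, eval_nonneg_of_ne (u₀ := u₀) hb fun u hu hne => ?_⟩
  have h2 := h u hu
  simp only [eval_mul, eval_sub, eval_X, eval_C, ← mul_assoc] at h2
  exact nonneg_of_mul_nonneg_right h2 (mul_self_pos.2 (sub_ne_zero.2 hne))

lemma exists_right_factor {b : ℝ} (hb : 0 < b) {P : ℝ[X]}
    (h : ∀ u ∈ Set.Icc (-b) b, 0 ≤ P.eval u) (h0 : P.eval b = 0) :
    ∃ Q : ℝ[X], P = (C b - X) * Q ∧ ∀ u ∈ Set.Icc (-b) b, 0 ≤ Q.eval u := by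
  obtain ⟨Q, rfl⟩ := dvd_iff_isRoot.2 h0
  refine ⟨-Q, by ring, eval_nonneg_of_ne (u₀ := b) hb fun u hu hne => ?_⟩
  have h2 := h u hu
  simp only [eval_mul, eval_sub, eval_X, eval_C, eval_neg] at h2 ⊢
  have h3 : u < b := lt_of_le_of_ne hu.2 hne
  nlinarith

lemma exists_left_factor {b : ℝ} (hb : 0 < b) {P : ℝ[X]}
    (h : ∀ u ∈ Set.Icc (-b) b, 0 ≤ P.eval u) (h0 : P.eval (-b) = 0) :
    ∃ Q : ℝ[X], P = (C b + X) * Q ∧ ∀ u ∈ Set.Icc (-b) b, 0 ≤ Q.eval u := by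
  obtain ⟨Q, rfl⟩ := dvd_iff_isRoot.2 h0
  refine ⟨Q, by rw [C_neg]; ring, eval_nonneg_of_ne (u₀ := -b) hb fun u hu hne => ?_⟩
  have h2 := h u hu
  simp only [eval_mul, eval_sub, eval_X, eval_C] at h2 ⊢
  have h3 : -b < u := lt_of_le_of_ne hu.1 (Ne.symm hne)
  nlinarith

lemma natDegree_C_sub_X (b : ℝ) : (C b - X : ℝ[X]).natDegree = 1 := by
  rw [← neg_sub, natDegree_neg, natDegree_X_sub_C]

lemma natDegree_C_add_X (b : ℝ) : (C b + X : ℝ[X]).natDegree = 1 := by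
  rw [add_comm, natDegree_X_add_C]

lemma degree_le_one_of_natDegree {l : ℝ[X]} (h : l.natDegree = 1) : l.degree ≤ 1 :=
  natDegree_le_iff_degree_le.1 h.le

lemma natDegree_X_sub_C_sq (u : ℝ) : ((X - C u : ℝ[X]) ^ 2).natDegree = 2 := by
  rw [natDegree_pow, natDegree_X_sub_C]

/-- `P` has the even-degree Lukács form with degree bound `2 * n`. -/
def LukacsEven (b : ℝ) (n : ℕ) (P : ℝ[X]) : Prop :=
  ∃ s₀ ∈ sosLT (n + 1), ∃ s₁ ∈ sosLT n, P = s₀ + (C b - X) * (C b + X) * s₁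

/-- `P` has the odd-degree Lukács form with degree bound `2 * n + 1`. -/
def LukacsOdd (b : ℝ) (n : ℕ) (P : ℝ[X]) : Prop :=
  ∃ s₀ ∈ sosLT (n + 1), ∃ s₁ ∈ sosLT (n + 1), P = (C b - X) * s₀ + (C b + X) * s₁

lemma ne_zero_of_natDegree_eq_one {l : ℝ[X]} (h : l.natDegree = 1) : l ≠ 0 := by
  rintro rfl
  simp at h

lemma lukacsEven_zero {b : ℝ} (hb : 0 < b) {P : ℝ[X]} (hd : P.natDegree ≤ 2 * 0)
    (h : ∀ u ∈ Set.Icc (-b) b, 0 ≤ P.eval u) : LukacsEven b 0 P := by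
  rw [mul_zero, Nat.le_zero] at hd
  obtain ⟨c, rfl⟩ := natDegree_eq_zero.1 hd
  refine ⟨C c, C_mem_sosLT 0 ?_, 0, zero_mem _, by simp⟩
  simpa using h 0 ⟨by linarith, hb.le⟩

lemma lukacsOdd_zero {b : ℝ} (hb : 0 < b) {P : ℝ[X]} (hd : P.natDegree ≤ 2 * 0 + 1)
    (h : ∀ u ∈ Set.Icc (-b) b, 0 ≤ P.eval u) : LukacsOdd b 0 P := by
  refine ⟨_, C_mem_sosLT 0 (c := P.eval (-b) / (2 * b)) ?_, _,
    C_mem_sosLT 0 (c := P.eval b / (2 * b)) ?_, ?_⟩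
  · exact div_nonneg (h _ ⟨le_rfl, by linarith⟩) (by linarith)
  · exact div_nonneg (h _ ⟨by linarith, le_rfl⟩) (by linarith)
  · rw [eq_X_add_C_of_natDegree_le_one hd]
    refine Polynomial.funext fun u => ?_
    simp only [eval_add, eval_mul, eval_sub, eval_C, eval_X]
    field_simp
    ring

lemma lukacsEven_succ {b : ℝ} (hb : 0 < b) {n : ℕ}
    (he : ∀ P : ℝ[X], P.natDegree ≤ 2 * n → (∀ u ∈ Set.Icc (-b) b, 0 ≤ P.eval u) →
      LukacsEven b n P)
    (ho : ∀ P : ℝ[X], P.natDegree ≤ 2 * n + 1 → (∀ u ∈ Set.Icc (-b) b, 0 ≤ P.eval u) →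
      LukacsOdd b n P)
    {P : ℝ[X]} (hd : P.natDegree ≤ 2 * (n + 1))
    (h : ∀ u ∈ Set.Icc (-b) b, 0 ≤ P.eval u) : LukacsEven b (n + 1) P := by
  obtain ⟨c, hc, R, rfl, hRd, hR, u₀, hu₀, h0⟩ := exists_sub_min hb h
  replace hRd := hRd.trans hd
  have hcm := C_mem_sosLT (n + 1) hc
  rcases eq_or_lt_of_le hu₀.1 with hl | hl
  · subst hl
    obtain ⟨Q, rfl, hQ⟩ := exists_left_factor hb hR h0
    have hl := natDegree_C_add_X b
    obtain ⟨s₀, hs₀, s₁, hs₁, rfl⟩ :=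
      ho Q (natDegree_le_of_mul hl (ne_zero_of_natDegree_eq_one hl) hRd) hQ
    exact ⟨_, add_mem hcm (sq_mul_mem_sosLT (degree_le_one_of_natDegree hl) hs₁), s₀, hs₀, by ring⟩
  rcases eq_or_lt_of_le hu₀.2 with hr | hr
  · subst hr
    obtain ⟨Q, rfl, hQ⟩ := exists_right_factor hb hR h0
    have hl := natDegree_C_sub_X u₀
    obtain ⟨s₀, hs₀, s₁, hs₁, rfl⟩ :=
      ho Q (natDegree_le_of_mul hl (ne_zero_of_natDegree_eq_one hl) hRd) hQ
    exact ⟨_, add_mem hcm (sq_mul_mem_sosLT (degree_le_one_of_natDegree hl) hs₀), s₁, hs₁, by ring⟩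
  obtain ⟨Q, rfl, hQ⟩ := exists_interior_factor ⟨hl, hr⟩ hR h0
  have hl := degree_le_one_of_natDegree (natDegree_X_sub_C u₀)
  obtain ⟨s₀, hs₀, s₁, hs₁, rfl⟩ := he Q
    (natDegree_le_of_mul (natDegree_X_sub_C_sq u₀) (pow_ne_zero 2 (X_sub_C_ne_zero u₀)) hRd) hQ
  exact ⟨_, add_mem hcm (sq_mul_mem_sosLT hl hs₀), _, sq_mul_mem_sosLT hl hs₁, by ring⟩

lemma lukacsOdd_succ {b : ℝ} (hb : 0 < b) {n : ℕ}
    (ho : ∀ P : ℝ[X], P.natDegree ≤ 2 * n + 1 → (∀ u ∈ Set.Icc (-b) b, 0 ≤ P.eval u) →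
      LukacsOdd b n P)
    (he : ∀ P : ℝ[X], P.natDegree ≤ 2 * (n + 1) → (∀ u ∈ Set.Icc (-b) b, 0 ≤ P.eval u) →
      LukacsEven b (n + 1) P)
    {P : ℝ[X]} (hd : P.natDegree ≤ 2 * (n + 1) + 1)
    (h : ∀ u ∈ Set.Icc (-b) b, 0 ≤ P.eval u) : LukacsOdd b (n + 1) P := by
  obtain ⟨c, hc, R, rfl, hRd, hR, u₀, hu₀, h0⟩ := exists_sub_min hb h
  replace hRd := hRd.trans hd
  have hcm := C_mem_sosLT (n + 1) (div_nonneg hc (by linarith : 0 ≤ 2 * b))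
  suffices LukacsOdd b (n + 1) R by
    obtain ⟨s₀, hs₀, s₁, hs₁, rfl⟩ := this
    refine ⟨_, add_mem hcm hs₀, _, add_mem hcm hs₁, ?_⟩
    have : C c = (C b - X) * C (c / (2 * b)) + (C b + X) * C (c / (2 * b)) := by
      rw [← add_mul, sub_add_add_cancel, ← C_add, ← C_mul]
      congr 1
      field_simp
      ring
    rw [this]
    ring
  rcases eq_or_lt_of_le hu₀.1 with hl | hl
  · subst hl
    obtain ⟨Q, rfl, hQ⟩ := exists_left_factor hb hR h0
    have hl := natDegree_C_add_X b
    obtain ⟨s₀, hs₀, s₁, hs₁, rfl⟩ :=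
      he Q (natDegree_le_of_mul hl (ne_zero_of_natDegree_eq_one hl) hRd) hQ
    exact ⟨_, sq_mul_mem_sosLT (degree_le_one_of_natDegree hl) hs₁, s₀, hs₀, by ring⟩
  rcases eq_or_lt_of_le hu₀.2 with hr | hr
  · subst hr
    obtain ⟨Q, rfl, hQ⟩ := exists_right_factor hb hR h0
    have hl := natDegree_C_sub_X u₀
    obtain ⟨s₀, hs₀, s₁, hs₁, rfl⟩ :=
      he Q (natDegree_le_of_mul hl (ne_zero_of_natDegree_eq_one hl) hRd) hQ
    exact ⟨s₀, hs₀, _, sq_mul_mem_sosLT (degree_le_one_of_natDegree hl) hs₁, by ring⟩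
  obtain ⟨Q, rfl, hQ⟩ := exists_interior_factor ⟨hl, hr⟩ hR h0
  have hl := degree_le_one_of_natDegree (natDegree_X_sub_C u₀)
  obtain ⟨s₀, hs₀, s₁, hs₁, rfl⟩ := ho Q
    (natDegree_le_of_mul (natDegree_X_sub_C_sq u₀) (pow_ne_zero 2 (X_sub_C_ne_zero u₀))
      (by omega)) hQ
  exact ⟨_, sq_mul_mem_sosLT hl hs₀, _, sq_mul_mem_sosLT hl hs₁, by ring⟩

/-- **Lukács' theorem** on polynomials nonnegative on `[-b, b]`. -/
theorem lukacs {b : ℝ} (hb : 0 < b) (n : ℕ) :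
    (∀ P : ℝ[X], P.natDegree ≤ 2 * n → (∀ u ∈ Set.Icc (-b) b, 0 ≤ P.eval u) →
      LukacsEven b n P) ∧
    (∀ P : ℝ[X], P.natDegree ≤ 2 * n + 1 → (∀ u ∈ Set.Icc (-b) b, 0 ≤ P.eval u) →
      LukacsOdd b n P) := by
  induction n with
  | zero => exact ⟨fun _ => lukacsEven_zero hb, fun _ => lukacsOdd_zero hb⟩
  | succ n ih =>
    have he := fun P : ℝ[X] => lukacsEven_succ hb ih.1 ih.2 (P := P)
    exact ⟨he, fun _ => lukacsOdd_succ hb ih.2 he⟩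

end Lukacs

section Steering

open Polynomial

/-- The steering vector `(1, e^{iφ}, …, e^{i(k-1)φ})`. -/
noncomputable def steering (k : ℕ) (φ : ℝ) : Fin k → ℂ :=
  fun n => Complex.exp (Complex.I * ((n : ℕ) : ℂ) * (φ : ℂ))

/-- The trigonometric polynomial `φ ↦ p(φ)ᴴ X p(φ)`. -/
noncomputable def trigForm {k : ℕ} (X : Matrix (Fin k) (Fin k) ℂ) (φ : ℝ) : ℂ :=
  star (steering k φ) ⬝ᵥ X *ᵥ steering k φ

lemma steering_eq_pow {k : ℕ} (φ : ℝ) (n : Fin k) :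
    steering k φ n = Complex.exp (Complex.I * φ) ^ (n : ℕ) := by
  rw [steering, ← Complex.exp_nat_mul]
  congr 1
  ring

lemma star_steering {k : ℕ} (φ : ℝ) (n : Fin k) :
    star (steering k φ n) = Complex.exp (-(Complex.I * φ)) ^ (n : ℕ) := by
  rw [steering_eq_pow, star_pow]
  simp [← Complex.exp_conj]

lemma trigForm_eq_sum {k : ℕ} (X : Matrix (Fin k) (Fin k) ℂ) (φ : ℝ) :
    trigForm X φ = ∑ a, ∑ b, X a b * (star (steering k φ a) * steering k φ b) := by
  simp only [trigForm, dotProduct, mulVec, Finset.mul_sum, Pi.star_apply]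
  exact Finset.sum_congr rfl fun a _ => Finset.sum_congr rfl fun b _ => by ring

lemma trigForm_add {k : ℕ} (X Y : Matrix (Fin k) (Fin k) ℂ) (φ : ℝ) :
    trigForm (X + Y) φ = trigForm X φ + trigForm Y φ := by
  simp [trigForm, add_mulVec]

lemma trigForm_smul {k : ℕ} (r : ℝ) (X : Matrix (Fin k) (Fin k) ℂ) (φ : ℝ) :
    trigForm (r • X) φ = r * trigForm X φ := by
  simp [trigForm, smul_mulVec]

lemma trigForm_vecMulVec {k : ℕ} (v : Fin k → ℂ) (φ : ℝ) :
    trigForm (vecMulVec (star v) v) φ = star (v ⬝ᵥ steering k φ) * (v ⬝ᵥ steering k φ) := by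
  rw [trigForm, vecMulVec_mulVec, dotProduct_smul, star_dotProduct_star]
  simp [mul_comm]

lemma continuous_trigForm {k : ℕ} (X : Matrix (Fin k) (Fin k) ℂ) : Continuous (trigForm X) := by
  simp only [funext (trigForm_eq_sum X), steering_eq_pow]
  fun_prop

lemma exists_real_part_poly {d : ℕ} {q : ℂ[X]} (hq : q.natDegree ≤ d) :
    ∃ P : ℝ[X], P.natDegree ≤ d ∧ ∀ u : ℝ, P.eval u = (q.eval (u : ℂ)).re := by
  refine ⟨∑ i ∈ Finset.range (d + 1), C (q.coeff i).re * X ^ i,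
    natDegree_sum_le_of_forall_le _ _ fun i hi => ?_, fun u => ?_⟩
  · exact (natDegree_C_mul_X_pow_le _ _).trans (Nat.lt_succ_iff.1 (Finset.mem_range.1 hi))
  · rw [eval_eq_sum_range' (Nat.lt_succ_iff.2 hq), eval_finsetSum, Complex.re_sum]
    refine Finset.sum_congr rfl fun i _ => ?_
    rw [← Complex.ofReal_pow, Complex.re_mul_ofReal]
    simp

lemma exp_half_angle {ψ : ℝ} (hc : Real.cos (ψ / 2) ≠ 0) :
    (Real.cos (ψ / 2) : ℂ) * (1 + Complex.I * Real.tan (ψ / 2)) = Complex.exp (Complex.I * (ψ / 2)) ∧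
    (Real.cos (ψ / 2) : ℂ) * (1 - Complex.I * Real.tan (ψ / 2)) =
      Complex.exp (-(Complex.I * (ψ / 2))) := by
  have hc' : (Real.cos (ψ / 2) : ℂ) ≠ 0 := by exact_mod_cast hc
  have h1 : Complex.exp (Complex.I * (ψ / 2)) = Real.cos (ψ / 2) + Real.sin (ψ / 2) * Complex.I := by
    rw [mul_comm, Complex.exp_mul_I]; push_cast; rfl
  have h2 : Complex.exp (-(Complex.I * (ψ / 2))) =
      Real.cos (ψ / 2) - Real.sin (ψ / 2) * Complex.I := by
    rw [mul_comm, ← neg_mul, Complex.exp_mul_I, Complex.cos_neg, Complex.sin_neg]; push_cast; ring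
  rw [h1, h2, Real.tan_eq_sin_div_cos, Complex.ofReal_div]
  constructor <;> field_simp

lemma steering_mul_half_angle {n : ℕ} (θ φ : ℝ) (hc : Real.cos ((φ - θ) / 2) ≠ 0) (a b : Fin (n + 1)) :
    star (steering (n + 1) φ a) * steering (n + 1) φ b =
      (Real.cos ((φ - θ) / 2) : ℂ) ^ (2 * n) *
      (Complex.exp (-(Complex.I * θ)) ^ (a : ℕ) *
        ((1 - Complex.I * Real.tan ((φ - θ) / 2)) ^ (a : ℕ) *
          (1 + Complex.I * Real.tan ((φ - θ) / 2)) ^ (n - a)) *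
      (Complex.exp (Complex.I * θ) ^ (b : ℕ) *
        ((1 + Complex.I * Real.tan ((φ - θ) / 2)) ^ (b : ℕ) *
          (1 - Complex.I * Real.tan ((φ - θ) / 2)) ^ (n - b)))) := by
  obtain ⟨h1, h2⟩ := exp_half_angle hc
  obtain ⟨a', ha⟩ := Nat.exists_eq_add_of_le (Nat.lt_succ_iff.1 a.2)
  obtain ⟨b', hb⟩ := Nat.exists_eq_add_of_le (Nat.lt_succ_iff.1 b.2)
  rw [star_steering, steering_eq_pow]
  set h := Complex.exp (Complex.I * (((φ - θ : ℝ) : ℂ) / 2)) with hh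
  set g := Complex.exp (-(Complex.I * (((φ - θ : ℝ) : ℂ) / 2))) with hg
  have hgh : h * g = 1 := by rw [hh, hg, ← Complex.exp_add, add_neg_cancel, Complex.exp_zero]
  have e1 : Complex.exp (Complex.I * φ) = Complex.exp (Complex.I * θ) * (h * h) := by
    rw [hh, ← Complex.exp_add, ← Complex.exp_add]; congr 1; push_cast; ring
  have e2 : Complex.exp (-(Complex.I * φ)) = Complex.exp (-(Complex.I * θ)) * (g * g) := by
    rw [hg, ← Complex.exp_add, ← Complex.exp_add]; congr 1; push_cast; ring
  have ha' : n - (a : ℕ) = a' := by omega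
  have hb' : n - (b : ℕ) = b' := by omega
  rw [e1, e2, ha', hb']
  generalize (Real.tan ((φ - θ) / 2) : ℂ) = u at *
  generalize (Real.cos ((φ - θ) / 2) : ℂ) = c at *
  have hcn : c ^ (2 * n) = c ^ (a : ℕ) * c ^ a' * (c ^ (b : ℕ) * c ^ b') := by
    rw [← pow_add, ← pow_add, ← ha, ← hb, ← pow_add, two_mul]
  generalize Complex.exp (Complex.I * θ) = t
  generalize Complex.exp (-(Complex.I * θ)) = t'
  have key : (g * g) ^ (a : ℕ) * (h * h) ^ (b : ℕ) =
      g ^ (a : ℕ) * h ^ a' * (h ^ (b : ℕ) * g ^ b') := by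
    have k1 : (h * g) ^ a' = 1 := by rw [hgh, one_pow]
    have k2 : (h * g) ^ (b : ℕ) = 1 := by rw [hgh, one_pow]
    have k3 : g ^ (a : ℕ) * g ^ a' = g ^ (b : ℕ) * g ^ b' := by
      rw [← pow_add, ← pow_add, ← ha, ← hb]
    calc (g * g) ^ (a : ℕ) * (h * h) ^ (b : ℕ)
        = (g * g) ^ (a : ℕ) * (h * h) ^ (b : ℕ) * (h * g) ^ a' := by rw [k1, mul_one]
      _ = g ^ (a : ℕ) * h ^ a' * (h ^ (b : ℕ) * h ^ (b : ℕ)) * (g ^ (a : ℕ) * g ^ a') := by ring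
      _ = g ^ (a : ℕ) * h ^ a' * (h ^ (b : ℕ) * g ^ b') * (h * g) ^ (b : ℕ) := by rw [k3]; ring
      _ = _ := by rw [k2, mul_one]
  calc _ = t' ^ (a : ℕ) * t ^ (b : ℕ) * ((g * g) ^ (a : ℕ) * (h * h) ^ (b : ℕ)) := by ring
    _ = _ := by
      rw [key, ← h1, ← h2, hcn]
      generalize 1 + Complex.I * u = v
      generalize 1 - Complex.I * u = w
      ring

/-- Half-angle substitution: `p(φ)ᴴ T p(φ)` is a real polynomial in `tan ((φ - θ) / 2)`, up to a
power of the cosine. -/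
lemma exists_poly_of_trigForm {n : ℕ} (θ : ℝ) (T : Matrix (Fin (n + 1)) (Fin (n + 1)) ℂ) :
    ∃ P : ℝ[X], P.natDegree ≤ 2 * n ∧ ∀ φ : ℝ, Real.cos ((φ - θ) / 2) ≠ 0 →
      (trigForm T φ).re =
        Real.cos ((φ - θ) / 2) ^ (2 * n) * P.eval (Real.tan ((φ - θ) / 2)) := by
  let q : ℂ[X] := ∑ a : Fin (n + 1), ∑ b : Fin (n + 1), C (T a b) *
      ((C (Complex.exp (-(Complex.I * θ)) ^ (a : ℕ)) *
        ((1 - C Complex.I * X) ^ (a : ℕ) * (1 + C Complex.I * X) ^ (n - a))) *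
      (C (Complex.exp (Complex.I * θ) ^ (b : ℕ)) *
        ((1 + C Complex.I * X) ^ (b : ℕ) * (1 - C Complex.I * X) ^ (n - b))))
  have hm : (1 - C Complex.I * X : ℂ[X]).natDegree ≤ 1 := by compute_degree
  have hp : (1 + C Complex.I * X : ℂ[X]).natDegree ≤ 1 := by compute_degree
  have hq : q.natDegree ≤ 2 * n := by
    refine natDegree_sum_le_of_forall_le _ _ fun a _ =>
      natDegree_sum_le_of_forall_le _ _ fun b _ => ?_
    refine (natDegree_C_mul_le _ _).trans ?_
    have h1 : (C (Complex.exp (-(Complex.I * θ)) ^ (a : ℕ)) *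
        ((1 - C Complex.I * X) ^ (a : ℕ) * (1 + C Complex.I * X) ^ (n - a))).natDegree ≤
        a * 1 + (n - a) * 1 := (natDegree_C_mul_le _ _).trans
      (natDegree_mul_le_of_le (natDegree_pow_le_of_le _ hm) (natDegree_pow_le_of_le _ hp))
    have h2 : (C (Complex.exp (Complex.I * θ) ^ (b : ℕ)) *
        ((1 + C Complex.I * X) ^ (b : ℕ) * (1 - C Complex.I * X) ^ (n - b))).natDegree ≤
        b * 1 + (n - b) * 1 := (natDegree_C_mul_le _ _).trans
      (natDegree_mul_le_of_le (natDegree_pow_le_of_le _ hp) (natDegree_pow_le_of_le _ hm))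
    refine (natDegree_mul_le_of_le h1 h2).trans ?_
    omega
  obtain ⟨P, hP, hPe⟩ := exists_real_part_poly hq
  refine ⟨P, hP, fun φ hc => ?_⟩
  rw [hPe, ← Complex.re_ofReal_mul, trigForm_eq_sum]
  congr 1
  simp only [q, eval_finsetSum, eval_mul, eval_C, eval_pow, eval_sub, eval_add, eval_one, eval_X,
    Finset.mul_sum]
  refine Finset.sum_congr rfl fun a _ => Finset.sum_congr rfl fun b _ => ?_
  rw [steering_mul_half_angle θ φ hc]
  push_cast
  ring

lemma exists_vec_of_poly {m : ℕ} (θ : ℝ) {f : ℝ[X]} (hf : f.degree < (m + 1 : ℕ)) :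
    ∃ v : Fin (m + 1) → ℂ, ∀ φ : ℝ, Real.cos ((φ - θ) / 2) ≠ 0 →
      Complex.exp (Complex.I * (((φ - θ : ℝ) : ℂ) / 2)) ^ m * (Real.cos ((φ - θ) / 2) ^ m *
        f.eval (Real.tan ((φ - θ) / 2)) : ℝ) = v ⬝ᵥ steering (m + 1) φ := by
  let e := Complex.exp (-(Complex.I * θ))
  let q : ℂ[X] := ∑ j ∈ Finset.range (m + 1), C (f.coeff j : ℂ) *
    ((C (e / (2 * Complex.I)) * X - C (1 / (2 * Complex.I))) ^ j *
      (C (e / 2) * X + C (1 / 2)) ^ (m - j))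
  have hq : q.natDegree < m + 1 := by
    refine Nat.lt_succ_iff.2 (natDegree_sum_le_of_forall_le _ _ fun j hj => ?_)
    have h1 : (C (e / (2 * Complex.I)) * X - C (1 / (2 * Complex.I))).natDegree ≤ 1 := by
      compute_degree
    have h2 : (C (e / 2) * X + C (1 / 2)).natDegree ≤ 1 := by compute_degree
    refine (natDegree_C_mul_le _ _).trans ((natDegree_mul_le_of_le (natDegree_pow_le_of_le _ h1)
      (natDegree_pow_le_of_le _ h2)).trans ?_)
    have := Finset.mem_range.1 hj
    omega
  have hf' : f.natDegree < m + 1 := by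
    by_cases h0 : f = 0
    · simp [h0]
    · exact (natDegree_lt_iff_degree_lt h0).2 hf
  refine ⟨fun i => q.coeff i, fun φ hc => ?_⟩
  have hr : (fun i : Fin (m + 1) => q.coeff i) ⬝ᵥ steering (m + 1) φ =
      q.eval (Complex.exp (Complex.I * φ)) := by
    rw [eval_eq_sum_range' hq, Finset.sum_range]
    simp only [dotProduct, steering_eq_pow]
  rw [hr, eval_eq_sum_range' hf']
  simp only [q, eval_finsetSum, eval_mul, eval_C, eval_pow, eval_sub, eval_add, eval_X,
    Complex.ofReal_mul, Complex.ofReal_sum, Complex.ofReal_pow, Finset.mul_sum]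
  refine Finset.sum_congr rfl fun j hj => ?_
  obtain ⟨i, hi⟩ := Nat.exists_eq_add_of_le (Nat.lt_succ_iff.1 (Finset.mem_range.1 hj))
  obtain ⟨h1, h2⟩ := exp_half_angle hc
  set h := Complex.exp (Complex.I * (((φ - θ : ℝ) : ℂ) / 2)) with hh
  set g := Complex.exp (-(Complex.I * (((φ - θ : ℝ) : ℂ) / 2))) with hg
  have hgh : h * g = 1 := by rw [hh, hg, ← Complex.exp_add, add_neg_cancel, Complex.exp_zero]
  have e1 : e * Complex.exp (Complex.I * φ) = h * h := by
    rw [hh, ← Complex.exp_add, ← Complex.exp_add]; congr 1; push_cast; ring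
  have s1 : e / (2 * Complex.I) * Complex.exp (Complex.I * φ) - 1 / (2 * Complex.I) =
      h * Real.cos ((φ - θ) / 2) * Real.tan ((φ - θ) / 2) := by
    rw [div_mul_eq_mul_div, e1, ← hgh, ← sub_div, div_eq_iff (by simp), ← mul_sub, ← h1, ← h2]
    ring
  have s2 : e / 2 * Complex.exp (Complex.I * φ) + 1 / 2 = h * Real.cos ((φ - θ) / 2) := by
    rw [div_mul_eq_mul_div, e1, ← hgh, ← add_div, div_eq_iff (by simp), ← mul_add, ← h1, ← h2]
    ring
  have hi' : m - j = i := by omega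
  rw [s1, s2, hi', hi]
  ring

lemma exists_posSemidef_of_mem_sosLT {k : ℕ} (θ : ℝ) {s : ℝ[X]} (hs : s ∈ sosLT (k + 1)) :
    ∃ Y : Matrix (Fin (k + 1)) (Fin (k + 1)) ℂ, Y.PosSemidef ∧
      ∀ φ : ℝ, Real.cos ((φ - θ) / 2) ≠ 0 → trigForm Y φ =
        (Real.cos ((φ - θ) / 2) ^ (2 * k) * s.eval (Real.tan ((φ - θ) / 2)) : ℝ) := by
  induction hs using AddSubmonoid.closure_induction with
  | mem q hq =>
    obtain ⟨f, hf, rfl⟩ := hq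
    obtain ⟨v, hv⟩ := exists_vec_of_poly θ hf
    refine ⟨vecMulVec (star v) v, ?_, fun φ hc => ?_⟩
    · simpa using posSemidef_vecMulVec_self_star (star v)
    · rw [trigForm_vecMulVec, ← hv φ hc, star_mul', star_pow, mul_mul_mul_comm, ← mul_pow]
      have : star (Complex.exp (Complex.I * (((φ - θ : ℝ) : ℂ) / 2))) *
          Complex.exp (Complex.I * (((φ - θ : ℝ) : ℂ) / 2)) = 1 := by
        have h2 : ((φ - θ : ℝ) : ℂ) / 2 = ((φ - θ) / 2 : ℝ) := by push_cast; rfl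
        rw [h2, Complex.star_def, ← Complex.exp_conj, map_mul, Complex.conj_I, Complex.conj_ofReal,
          ← Complex.exp_add]
        simp
      rw [this, one_pow, one_mul, Complex.star_def, Complex.conj_ofReal, ← Complex.ofReal_mul,
        eval_pow]
      congr 1
      ring
  | zero => exact ⟨0, PosSemidef.zero, fun φ _ => by simp [trigForm]⟩
  | add a b _ _ ha hb =>
    obtain ⟨Y, hY, hYe⟩ := ha
    obtain ⟨Z, hZ, hZe⟩ := hb
    refine ⟨Y + Z, hY.add hZ, fun φ hc => ?_⟩
    rw [trigForm_add, hYe φ hc, hZe φ hc, ← Complex.ofReal_add, eval_add, mul_add]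

lemma trigForm_ofReal_re {k : ℕ} {T : Matrix (Fin k) (Fin k) ℂ} (hT : T.IsHermitian) (φ : ℝ) :
    ((trigForm T φ).re : ℂ) = trigForm T φ :=
  Complex.conj_eq_iff_re.1 (by
    have := hT.im_star_dotProduct_mulVec_self (steering k φ)
    exact Complex.conj_eq_iff_im.2 this)

lemma dense_cos_half_ne_zero (θ : ℝ) : Dense {φ : ℝ | Real.cos ((φ - θ) / 2) ≠ 0} := by
  have h : {φ : ℝ | Real.cos ((φ - θ) / 2) ≠ 0} = {φ : ℝ | Real.cos ((φ - θ) / 2) = 0}ᶜ := rfl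
  rw [h]
  refine Set.Countable.dense_compl ℝ ?_
  refine (Set.countable_range fun j : ℤ => (2 * j + 1) * Real.pi + θ).mono fun φ hφ => ?_
  obtain ⟨j, hj⟩ := Real.cos_eq_zero_iff.1 hφ
  exact ⟨j, by simp only; linarith⟩

/-- A trigonometric polynomial nonnegative on the arc `[θ - β, θ + β]` is a sum of squares plus
`cos (φ - θ) - cos β` times a sum of squares. -/
theorem trigForm_nonneg_on_arc {N : ℕ} (hN : 2 ≤ N) (θ β : ℝ) (hβ : β ∈ Set.Ioo 0 Real.pi)
    {T : Matrix (Fin (N)) (Fin (N)) ℂ} (hT : T.IsHermitian)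
    (h : ∀ φ ∈ Set.Icc (θ - β) (θ + β), 0 ≤ (trigForm T φ).re) :
    ∃ (X₁ : Matrix (Fin (N)) (Fin (N)) ℂ) (X₂ : Matrix (Fin (N - 1)) (Fin (N - 1)) ℂ),
      X₁.PosSemidef ∧ X₂.PosSemidef ∧ ∀ φ : ℝ, trigForm T φ =
        trigForm X₁ φ + ((Real.cos (φ - θ) - Real.cos β : ℝ) : ℂ) * trigForm X₂ φ := by
  obtain ⟨n, rfl⟩ := Nat.exists_eq_add_of_le' hN
  obtain ⟨P, hPd, hP⟩ := exists_poly_of_trigForm θ T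
  have hβ2 : β / 2 ∈ Set.Ioo (-(Real.pi / 2)) (Real.pi / 2) :=
    ⟨by linarith [hβ.1, Real.pi_pos], by linarith [hβ.2]⟩
  have hb : 0 < Real.tan (β / 2) := Real.tan_pos_of_pos_of_lt_pi_div_two (by linarith [hβ.1]) hβ2.2
  have hnn : ∀ u ∈ Set.Icc (-Real.tan (β / 2)) (Real.tan (β / 2)), 0 ≤ P.eval u := by
    intro u hu
    have ha : Real.arctan u ≤ β / 2 := by
      rw [← Real.arctan_tan hβ2.1 hβ2.2]
      exact Real.arctan_mono hu.2
    have hb : -(β / 2) ≤ Real.arctan u := by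
      rw [← Real.arctan_tan hβ2.1 hβ2.2, ← Real.arctan_neg]
      exact Real.arctan_mono hu.1
    have hφ : (θ + 2 * Real.arctan u - θ) / 2 = Real.arctan u := by ring
    have hc := Real.cos_arctan_pos u
    have h1 := h (θ + 2 * Real.arctan u) ⟨by linarith, by linarith⟩
    rw [hP _ (by rw [hφ]; exact hc.ne'), hφ, Real.tan_arctan] at h1
    exact nonneg_of_mul_nonneg_right h1 (pow_pos hc _)
  obtain ⟨s₀, hs₀, s₁, hs₁, hPs⟩ := (lukacs hb (n + 1)).1 P hPd hnn
  obtain ⟨Y, hY, hYe⟩ := exists_posSemidef_of_mem_sosLT θ hs₀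
  obtain ⟨Z, hZ, hZe⟩ := exists_posSemidef_of_mem_sosLT θ hs₁
  have hcb : 0 < Real.cos (β / 2) := Real.cos_pos_of_mem_Ioo hβ2
  refine ⟨Y, (1 / (2 * Real.cos (β / 2) ^ 2)) • Z, hY, hZ.smul (by positivity), ?_⟩
  refine congrFun (g := fun φ => trigForm Y φ + ((Real.cos (φ - θ) - Real.cos β : ℝ) : ℂ) *
    trigForm ((1 / (2 * Real.cos (β / 2) ^ 2)) • Z) φ) (Continuous.ext_on
      (dense_cos_half_ne_zero θ) (continuous_trigForm T) ?_ fun φ hφ => ?_)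
  · have := continuous_trigForm Y
    have := continuous_trigForm ((1 / (2 * Real.cos (β / 2) ^ 2)) • Z)
    fun_prop
  · have hφ' : Real.cos ((φ - θ) / 2) ≠ 0 := hφ
    rw [← trigForm_ofReal_re hT, hP φ hφ', trigForm_smul, hYe φ hφ', hZe φ hφ', ← Complex.ofReal_mul,
      ← Complex.ofReal_mul, ← Complex.ofReal_add, hPs]
    congr 1
    have c1 : Real.cos (φ - θ) = 2 * Real.cos ((φ - θ) / 2) ^ 2 - 1 := by
      rw [← Real.cos_two_mul]; congr 1; ring
    have c2 : Real.cos β = 2 * Real.cos (β / 2) ^ 2 - 1 := by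
      rw [← Real.cos_two_mul]; congr 1; ring
    have t1 : Real.tan ((φ - θ) / 2) ^ 2 = 1 / Real.cos ((φ - θ) / 2) ^ 2 - 1 := by
      rw [← Real.inv_one_add_tan_sq hφ']; simp
    have t2 : Real.tan (β / 2) ^ 2 = 1 / Real.cos (β / 2) ^ 2 - 1 := by
      rw [← Real.inv_one_add_tan_sq hcb.ne']; simp
    have hw : (Real.tan (β / 2) - Real.tan ((φ - θ) / 2)) *
        (Real.tan (β / 2) + Real.tan ((φ - θ) / 2)) =
        1 / Real.cos (β / 2) ^ 2 - 1 / Real.cos ((φ - θ) / 2) ^ 2 := by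
      linear_combination t2 - t1
    simp only [eval_add, eval_mul, eval_sub, eval_C, eval_X]
    rw [hw, c1, c2]
    field_simp
    ring

end Steering

section Sampling

/-- The `m`-th DFT frequency `2πm/M`. -/
noncomputable def sampleFreq (M m : ℕ) : ℝ := 2 * Real.pi * m / M

/-- The character `φ ↦ e^{ilφ}`. -/
noncomputable def expChar (l : ℤ) (φ : ℝ) : ℂ := Complex.exp (Complex.I * l * φ)

/-- Trigonometric polynomials of degree at most `n`. -/
noncomputable def trigPoly (n : ℕ) : Submodule ℂ (ℝ → ℂ) :=
  Submodule.span ℂ (expChar '' Set.Icc (-n : ℤ) n)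

lemma expChar_mem {n : ℕ} {l : ℤ} (hl : l ∈ Set.Icc (-n : ℤ) n) : expChar l ∈ trigPoly n :=
  Submodule.subset_span ⟨l, hl, rfl⟩

lemma expChar_add (k l : ℤ) (φ : ℝ) : expChar (k + l) φ = expChar k φ * expChar l φ := by
  rw [expChar, expChar, expChar, ← Complex.exp_add]
  congr 1
  push_cast
  ring

lemma expChar_sub_arg (l : ℤ) (φ ω : ℝ) : expChar l (φ - ω) = expChar l φ * expChar (-l) ω := by
  rw [expChar, expChar, expChar, ← Complex.exp_add]
  congr 1
  push_cast
  ring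

lemma star_expChar (l : ℤ) (φ : ℝ) : star (expChar l φ) = expChar (-l) φ := by
  rw [expChar, expChar, Complex.star_def, ← Complex.exp_conj]
  simp

lemma star_steering_mul {k : ℕ} (a b : Fin k) (φ : ℝ) :
    star (steering k φ a) * steering k φ b = expChar ((b : ℤ) - a) φ := by
  have h (c : Fin k) : steering k φ c = expChar (c : ℕ) φ := by simp [steering, expChar]
  rw [h, h, star_expChar, ← expChar_add]
  congr 1
  ring

lemma sum_expChar_sampleFreq {M : ℕ} {l : ℤ} (hl : |l| < M) :
    ∑ m : Fin M, expChar l (sampleFreq M m) = if l = 0 then (M : ℂ) else 0 := by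
  split_ifs with h0
  · simp [h0, expChar]
  have hM : M ≠ 0 := by rintro rfl; exact absurd hl (by simp)
  have hζ := Complex.isPrimitiveRoot_exp M hM
  set ζ := Complex.exp (2 * Real.pi * Complex.I / M) with hζd
  have h1 (m : Fin M) : expChar l (sampleFreq M m) = (ζ ^ l) ^ (m : ℕ) := by
    rw [hζd, ← Complex.exp_int_mul, ← Complex.exp_nat_mul, expChar, sampleFreq]
    congr 1
    push_cast
    ring
  simp only [h1]
  rw [← Finset.sum_range (fun m => (ζ ^ l) ^ m)]
  have h2 : ζ ^ l ≠ 1 := by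
    rw [Ne, hζ.zpow_eq_one_iff_dvd]
    intro hd
    exact h0 (Int.eq_zero_of_abs_lt_dvd hd hl)
  rw [geom_sum_eq h2, ← zpow_natCast, ← _root_.zpow_mul, mul_comm, _root_.zpow_mul, zpow_natCast,
    hζ.pow_eq_one]
  simp

lemma trigPoly_interpolation {n M : ℕ} (hM : 2 * n < M) {f : ℝ → ℂ} (hf : f ∈ trigPoly n) (φ : ℝ) :
    M * f φ = ∑ j ∈ Finset.Icc (-n : ℤ) n, expChar j φ *
      ∑ m : Fin M, expChar (-j) (sampleFreq M m) * f (sampleFreq M m) := by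
  induction hf using Submodule.span_induction with
  | mem f hf =>
    obtain ⟨l, hl, rfl⟩ := hf
    have h (j : ℤ) (hj : j ∈ Finset.Icc (-n : ℤ) n) :
        expChar j φ * ∑ m : Fin M, expChar (-j) (sampleFreq M m) * expChar l (sampleFreq M m) =
          if j = l then M * expChar l φ else 0 := by
      simp only [← expChar_add]
      rw [Finset.mem_Icc] at hj
      rw [sum_expChar_sampleFreq (by rw [abs_lt]; constructor <;> linarith [hl.1, hl.2])]
      by_cases hjl : j = l
      · simp [hjl, mul_comm]
      · rw [if_neg hjl, if_neg (by omega), mul_zero]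
    rw [Finset.sum_congr rfl h, Finset.sum_ite_eq', if_pos (Finset.mem_Icc.2 hl)]
  | zero => simp
  | add f g _ _ hf hg => simp only [Pi.add_apply, mul_add, hf, hg, Finset.sum_add_distrib]
  | smul c f _ hf =>
    simp only [Pi.smul_apply, smul_eq_mul, mul_left_comm _ c, hf, Finset.mul_sum]

/-- A real trigonometric polynomial is determined by its nonnegative-index DFT coefficients. -/
lemma eq_zero_of_dft_eq_zero {n M : ℕ} (hM : 2 * n < M) {f : ℝ → ℂ} (hf : f ∈ trigPoly n)
    (hreal : ∀ φ, star (f φ) = f φ)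
    (h : ∀ k : ℕ, k ≤ n → ∑ m : Fin M, expChar k (sampleFreq M m) * f (sampleFreq M m) = 0)
    (φ : ℝ) : f φ = 0 := by
  have hM' : (M : ℂ) ≠ 0 := by exact_mod_cast (by omega : M ≠ 0)
  refine (mul_eq_zero.1 ?_).resolve_left hM'
  rw [trigPoly_interpolation hM hf]
  refine Finset.sum_eq_zero fun j hj => mul_eq_zero_of_right _ ?_
  rw [Finset.mem_Icc] at hj
  rcases le_total j 0 with hj0 | hj0
  · have := h (-j).toNat (by omega)
    rwa [Int.toNat_of_nonneg (by omega)] at this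
  · have := h j.toNat (by omega)
    rw [Int.toNat_of_nonneg hj0] at this
    simpa [star_sum, star_expChar, hreal] using congrArg star this

lemma trigForm_mem_trigPoly {k n : ℕ} (hk : k ≤ n + 1) (X : Matrix (Fin k) (Fin k) ℂ) :
    trigForm X ∈ trigPoly n := by
  have h : trigForm X = ∑ a, ∑ b, X a b • expChar ((b : ℤ) - a) := by
    ext φ
    simp only [trigForm_eq_sum, star_steering_mul, Finset.sum_apply, Pi.smul_apply, smul_eq_mul]
  rw [h]
  refine Submodule.sum_mem _ fun a _ => Submodule.sum_mem _ fun b _ =>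
    Submodule.smul_mem _ _ (expChar_mem ⟨?_, ?_⟩) <;> omega

lemma cos_sub_mul_mem_trigPoly {n : ℕ} (θ c : ℝ) {f : ℝ → ℂ} (hf : f ∈ trigPoly n) :
    (fun φ => ((Real.cos (φ - θ) - c : ℝ) : ℂ) * f φ) ∈ trigPoly (n + 1) := by
  induction hf using Submodule.span_induction with
  | mem f hf =>
    obtain ⟨l, hl, rfl⟩ := hf
    have h : (fun φ => ((Real.cos (φ - θ) - c : ℝ) : ℂ) * expChar l φ) =
        (expChar (-1) θ / 2) • expChar (1 + l) + (expChar 1 θ / 2) • expChar (-1 + l) -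
          (c : ℂ) • expChar l := by
      ext φ
      have h1 : ((Real.cos (φ - θ) : ℝ) : ℂ) = (expChar 1 (φ - θ) + expChar (-1) (φ - θ)) / 2 := by
        rw [Complex.ofReal_cos, Complex.cos, expChar, expChar]
        congr 3 <;> (push_cast; ring)
      rw [Complex.ofReal_sub, h1, expChar_sub_arg, expChar_sub_arg, neg_neg]
      simp only [Pi.add_apply, Pi.sub_apply, Pi.smul_apply, smul_eq_mul, expChar_add]
      ring
    rw [h]
    have := hl.1
    have := hl.2
    refine sub_mem (add_mem ?_ ?_) ?_ <;>
      refine Submodule.smul_mem _ _ (expChar_mem ⟨?_, ?_⟩) <;> push_cast <;> omega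
  | zero =>
    simp only [Pi.zero_apply, mul_zero]
    exact zero_mem _
  | add f g _ _ hf hg =>
    simp only [Pi.add_apply, mul_add]
    exact add_mem hf hg
  | smul a f _ hf =>
    simp only [Pi.smul_apply, smul_eq_mul, mul_left_comm _ a]
    exact Submodule.smul_mem _ a hf

/-- The sum of the entries of `T` on its `k`-th subdiagonal. -/
noncomputable def diagSum {N : ℕ} (T : Matrix (Fin N) (Fin N) ℂ) (k : Fin N) : ℂ :=
  ∑ n : Fin N, ∑ m : Fin N, if (n : ℕ) = (m : ℕ) + (k : ℕ) then T n m else 0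

lemma dft_trigForm {N M : ℕ} (hM : 2 * N - 1 ≤ M) (T : Matrix (Fin N) (Fin N) ℂ) (k : Fin N) :
    ∑ m : Fin M, expChar (k : ℕ) (sampleFreq M m) * trigForm T (sampleFreq M m) =
      M * diagSum T k := by
  simp only [trigForm_eq_sum, star_steering_mul, Finset.mul_sum, diagSum]
  rw [Finset.sum_comm]
  refine Finset.sum_congr rfl fun a _ => ?_
  rw [Finset.sum_comm]
  refine Finset.sum_congr rfl fun b _ => ?_
  have ha := a.2
  have hb := b.2
  have hk := k.2
  simp only [mul_left_comm _ (T a b), ← expChar_add]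
  rw [← Finset.mul_sum, sum_expChar_sampleFreq (by rw [abs_lt]; constructor <;> omega)]
  by_cases h : (a : ℕ) = b + k
  · rw [if_pos h, if_pos (by omega), mul_comm]
  · rw [if_neg h, if_neg (by omega), mul_zero, mul_zero]

lemma dft_diag_eq_trigForm {k M : ℕ} {W : Matrix (Fin M) (Fin k) ℂ}
    (hW : ∀ m n, W m n =
      Complex.exp (-Complex.I * ((m : ℕ) : ℂ) * ((n : ℕ) : ℂ) * (2 * Real.pi / M)))
    (X : Matrix (Fin k) (Fin k) ℂ) (m : Fin M) :
    (W * X * Wᴴ) m m = trigForm X (sampleFreq M m) := by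
  have h (n : Fin k) : star (W m n) = steering k (sampleFreq M m) n := by
    rw [hW, steering, Complex.star_def, ← Complex.exp_conj, sampleFreq]
    congr 1
    simp only [map_mul, map_neg, map_div₀, Complex.conj_I, Complex.conj_ofReal, map_natCast,
      map_ofNat]
    push_cast
    ring
  rw [trigForm_eq_sum, Matrix.mul_assoc, Matrix.mul_apply]
  refine Finset.sum_congr rfl fun a _ => ?_
  rw [Matrix.mul_apply, Finset.mul_sum]
  refine Finset.sum_congr rfl fun b _ => ?_
  rw [conjTranspose_apply, h, ← h a, star_star]
  ring

lemma conjTranspose_dft_mulVec {N M : ℕ} {W : Matrix (Fin M) (Fin N) ℂ}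
    (hW : ∀ m n, W m n =
      Complex.exp (-Complex.I * ((m : ℕ) : ℂ) * ((n : ℕ) : ℂ) * (2 * Real.pi / M)))
    (v : Fin M → ℂ) (k : Fin N) :
    (Wᴴ *ᵥ v) k = ∑ m : Fin M, expChar (k : ℕ) (sampleFreq M m) * v m := by
  rw [mulVec, dotProduct]
  refine Finset.sum_congr rfl fun m _ => ?_
  rw [conjTranspose_apply, hW, expChar, Complex.star_def, ← Complex.exp_conj, sampleFreq]
  congr 2
  simp only [map_mul, map_neg, map_div₀, Complex.conj_I, Complex.conj_ofReal, map_natCast,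
    map_ofNat]
  push_cast
  ring

end Sampling

lemma trigForm_re_nonneg {k : ℕ} {X : Matrix (Fin k) (Fin k) ℂ} (hX : X.PosSemidef) (φ : ℝ) :
    0 ≤ (trigForm X φ).re :=
  hX.re_dotProduct_nonneg (steering k φ)

/-- The linear matrix inequality characterizes nonnegativity on the arc `[θ - β, θ + β]`. -/
theorem exists_sdp_feasible_iff {N M : ℕ} (hN : 2 ≤ N) (hM : 2 * N - 1 ≤ M) {θ β : ℝ}
    (hβ : β ∈ Set.Ioo 0 Real.pi)
    {W : Matrix (Fin M) (Fin N) ℂ}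
    (hW : ∀ m n, W m n =
      Complex.exp (-Complex.I * ((m : ℕ) : ℂ) * ((n : ℕ) : ℂ) * (2 * Real.pi / M)))
    {W₁ : Matrix (Fin M) (Fin (N - 1)) ℂ}
    (hW₁ : ∀ m n, W₁ m n =
      Complex.exp (-Complex.I * ((m : ℕ) : ℂ) * ((n : ℕ) : ℂ) * (2 * Real.pi / M)))
    {d : Fin M → ℝ} (hd : ∀ k : Fin M, d k = Real.cos (2 * Real.pi * (k : ℕ) / M - θ) - Real.cos β)
    {T : Matrix (Fin N) (Fin N) ℂ} (hT : T.IsHermitian) :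
    (∃ (X₁ : Matrix (Fin N) (Fin N) ℂ) (X₂ : Matrix (Fin (N - 1)) (Fin (N - 1)) ℂ),
      X₁.PosSemidef ∧ X₂.PosSemidef ∧ diagSum T = Wᴴ *ᵥ (fun m : Fin M =>
        (W * X₁ * Wᴴ) m m + (d m : ℂ) * ((W₁ * X₂ * W₁ᴴ) m m))) ↔
      ∀ φ ∈ Set.Icc (θ - β) (θ + β), 0 ≤ (trigForm T φ).re := by
  have hM0 : (M : ℂ) ≠ 0 := by exact_mod_cast (by omega : M ≠ 0)
  constructor
  · rintro ⟨X₁, X₂, h₁, h₂, h⟩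
    let g : ℝ → ℂ := fun φ =>
      trigForm X₁ φ + ((Real.cos (φ - θ) - Real.cos β : ℝ) : ℂ) * trigForm X₂ φ
    have hg : g ∈ trigPoly (N - 1) := by
      obtain ⟨n, rfl⟩ := Nat.exists_eq_add_of_le' hN
      exact add_mem (trigForm_mem_trigPoly (by omega) X₁)
        (cos_sub_mul_mem_trigPoly θ _ (trigForm_mem_trigPoly (by omega) X₂))
    have hf : trigForm T - (M : ℂ) • g ∈ trigPoly (N - 1) :=
      sub_mem (trigForm_mem_trigPoly (by omega) T) (Submodule.smul_mem _ _ hg)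
    have hgr (φ : ℝ) : g φ = ((trigForm X₁ φ).re +
        (Real.cos (φ - θ) - Real.cos β) * (trigForm X₂ φ).re : ℝ) := by
      rw [Complex.ofReal_add, Complex.ofReal_mul, trigForm_ofReal_re h₁.1, trigForm_ofReal_re h₂.1]
    have hzero := eq_zero_of_dft_eq_zero (M := M) (by omega) hf (fun φ => by
      rw [Pi.sub_apply, Pi.smul_apply, hgr φ, ← trigForm_ofReal_re hT φ]
      simp only [smul_eq_mul, Complex.star_def, map_sub, map_mul, map_natCast,
        Complex.conj_ofReal]) (fun k hk => by
      have hk' := congrFun h ⟨k, by omega⟩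
      rw [conjTranspose_dft_mulVec hW] at hk'
      simp only [dft_diag_eq_trigForm hW, dft_diag_eq_trigForm hW₁, hd] at hk'
      have := dft_trigForm hM T ⟨k, by omega⟩
      simp only [Pi.sub_apply, Pi.smul_apply, smul_eq_mul, mul_sub, Finset.sum_sub_distrib,
        mul_left_comm _ (M : ℂ)]
      rw [this, hk', ← Finset.mul_sum, ← mul_sub, ← Finset.sum_sub_distrib]
      refine mul_eq_zero_of_right _ (Finset.sum_eq_zero fun m _ => ?_)
      rw [sub_eq_zero]
      rfl)
    intro φ hφ
    have h0 : trigForm T φ = (M : ℂ) * g φ := sub_eq_zero.1 (hzero φ)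
    rw [h0, hgr, ← Complex.ofReal_natCast, ← Complex.ofReal_mul, Complex.ofReal_re]
    have hcos : Real.cos β ≤ Real.cos (φ - θ) := by
      rw [← Real.cos_abs (φ - θ)]
      exact Real.cos_le_cos_of_nonneg_of_le_pi (abs_nonneg _) hβ.2.le
        (abs_le.2 ⟨by linarith [hφ.1], by linarith [hφ.2]⟩)
    exact mul_nonneg (Nat.cast_nonneg M) (add_nonneg (trigForm_re_nonneg h₁ φ)
      (mul_nonneg (sub_nonneg.2 hcos) (trigForm_re_nonneg h₂ φ)))
  · intro h
    obtain ⟨X₁, X₂, h₁, h₂, hX⟩ := trigForm_nonneg_on_arc hN θ β hβ hT h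
    refine ⟨(M : ℝ)⁻¹ • X₁, (M : ℝ)⁻¹ • X₂, h₁.smul (by positivity), h₂.smul (by positivity), ?_⟩
    ext k
    rw [conjTranspose_dft_mulVec hW]
    simp only [dft_diag_eq_trigForm hW, dft_diag_eq_trigForm hW₁, hd, trigForm_smul]
    refine mul_left_cancel₀ hM0 ?_
    rw [← dft_trigForm hM, Finset.mul_sum]
    refine Finset.sum_congr rfl fun m _ => ?_
    rw [hX, sampleFreq]
    push_cast
    field_simp

/-- The optimal value `t*` of the semidefinite program
`minimize t` over `t ∈ ℝ≥0`, `X₁ ⪰ 0`, `X₂ ⪰ 0` subject to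
`t·y − x = Wᴴ[diag(W X₁ Wᴴ) + d ∘ diag(W₁ X₂ W₁ᴴ)]`
equals `max_{φ ∈ [θ−β, θ+β]} F(φ)`, where
`F(φ) = (p(φ)ᴴ A p(φ)) / (p(φ)ᴴ B p(φ))` with `A = C⁻¹ z zᴴ C⁻¹`, `B = C⁻¹`,
`x_k = Σ_{m−n=−k} A_{nm}`, `y_k = Σ_{m−n=−k} B_{nm}` (so `x₀ = tr A`, `y₀ = tr B`),
and `p(φ) = (1, e^{iφ}, …, e^{i(N−1)φ})ᵀ`. -/
theorem sdp_computes_max_F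
    (N M : ℕ) (hN : 2 ≤ N) (hM : 2 * N - 1 ≤ M)
    (θ β : ℝ) (hβ : β ∈ Set.Ioo 0 Real.pi)
    (C : Matrix (Fin N) (Fin N) ℂ) (hC : C.PosDef)
    (z : Fin N → ℂ) (hz : z ≠ 0)
    (A B : Matrix (Fin N) (Fin N) ℂ)
    (hA : A = C⁻¹ * vecMulVec z (star z) * C⁻¹) (hB : B = C⁻¹)
    (x y : Fin N → ℂ)
    (hx : ∀ k : Fin N, x k =
      ∑ n : Fin N, ∑ m : Fin N, if (n : ℕ) = (m : ℕ) + (k : ℕ) then A n m else 0)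
    (hy : ∀ k : Fin N, y k =
      ∑ n : Fin N, ∑ m : Fin N, if (n : ℕ) = (m : ℕ) + (k : ℕ) then B n m else 0)
    (p : ℝ → (Fin N → ℂ))
    (hp : ∀ φ : ℝ, ∀ n : Fin N, p φ n = Complex.exp (Complex.I * ((n : ℕ) : ℂ) * (φ : ℂ)))
    (F : ℝ → ℝ)
    (hF : ∀ φ : ℝ, F φ =
      (star (p φ) ⬝ᵥ A *ᵥ (p φ)).re / (star (p φ) ⬝ᵥ B *ᵥ (p φ)).re)
    (W : Matrix (Fin M) (Fin N) ℂ)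
    (hW : ∀ m n, W m n =
      Complex.exp (-Complex.I * ((m : ℕ) : ℂ) * ((n : ℕ) : ℂ) * (2 * Real.pi / M)))
    (W₁ : Matrix (Fin M) (Fin (N - 1)) ℂ)
    (hW₁ : ∀ m n, W₁ m n =
      Complex.exp (-Complex.I * ((m : ℕ) : ℂ) * ((n : ℕ) : ℂ) * (2 * Real.pi / M)))
    (d : Fin M → ℝ)
    (hd : ∀ k : Fin M, d k = Real.cos (2 * Real.pi * (k : ℕ) / M - θ) - Real.cos β) :
    ∃ tstar : ℝ,
      IsLeast {t : ℝ | 0 ≤ t ∧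
          ∃ (X₁ : Matrix (Fin N) (Fin N) ℂ) (X₂ : Matrix (Fin (N - 1)) (Fin (N - 1)) ℂ),
            X₁.PosSemidef ∧ X₂.PosSemidef ∧
            (fun k : Fin N => (t : ℂ) * y k - x k)
              = Wᴴ *ᵥ (fun m : Fin M =>
                  (W * X₁ * Wᴴ) m m + (d m : ℂ) * ((W₁ * X₂ * W₁ᴴ) m m))} tstar ∧
      IsGreatest {r : ℝ | ∃ φ ∈ Set.Icc (θ - β) (θ + β), r = F φ} tstar := by
  have hpN : ∀ φ, p φ = steering N φ := fun φ => funext (hp φ)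
  have hBpd : B.PosDef := hB ▸ hC.inv
  have hApsd : A.PosSemidef := by
    have h := (posSemidef_vecMulVec_self_star z).mul_mul_conjTranspose_same C⁻¹
    rwa [hC.inv.isHermitian.eq, ← hA] at h
  have hBpos (φ : ℝ) : 0 < (trigForm B φ).re := by
    refine hBpd.re_dotProduct_pos fun h => ?_
    exact Complex.exp_ne_zero _ (congrFun h ⟨0, by omega⟩)
  have hFe (φ : ℝ) : F φ = (trigForm A φ).re / (trigForm B φ).re := by rw [hF, hpN]; rfl
  have hFc : Continuous F := by
    rw [funext hFe]
    exact (Complex.continuous_re.comp (continuous_trigForm A)).div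
      (Complex.continuous_re.comp (continuous_trigForm B)) fun φ => (hBpos φ).ne'
  obtain ⟨φ₀, hφ₀, hmax⟩ := isCompact_Icc.exists_isMaxOn
    (Set.nonempty_Icc.2 (by linarith [hβ.1] : θ - β ≤ θ + β)) hFc.continuousOn
  have hT (t : ℝ) : (t • B + (-1 : ℝ) • A).IsHermitian :=
    (hBpd.isHermitian.smul (IsSelfAdjoint.all t)).add
      (hApsd.isHermitian.smul (IsSelfAdjoint.all (-1 : ℝ)))
  have hdiag (t : ℝ) : (fun k : Fin N => (t : ℂ) * y k - x k) =
      diagSum (t • B + (-1 : ℝ) • A) := by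
    ext k
    simp only [hx, hy, diagSum, Finset.mul_sum, ← Finset.sum_sub_distrib]
    refine Finset.sum_congr rfl fun n _ => Finset.sum_congr rfl fun m _ => ?_
    split_ifs <;> simp [sub_eq_add_neg]
  have hfeas (t : ℝ) : (∃ (X₁ : Matrix (Fin N) (Fin N) ℂ)
      (X₂ : Matrix (Fin (N - 1)) (Fin (N - 1)) ℂ), X₁.PosSemidef ∧ X₂.PosSemidef ∧
        (fun k : Fin N => (t : ℂ) * y k - x k) = Wᴴ *ᵥ (fun m : Fin M =>
          (W * X₁ * Wᴴ) m m + (d m : ℂ) * ((W₁ * X₂ * W₁ᴴ) m m))) ↔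
      ∀ φ ∈ Set.Icc (θ - β) (θ + β), F φ ≤ t := by
    rw [hdiag, exists_sdp_feasible_iff hN hM hβ hW hW₁ hd (hT t)]
    refine forall₂_congr fun φ _ => ?_
    rw [trigForm_add, trigForm_smul, trigForm_smul, hFe, div_le_iff₀ (hBpos φ), Complex.add_re,
      Complex.re_ofReal_mul, Complex.re_ofReal_mul]
    constructor <;> intro h <;> linarith
  refine ⟨F φ₀, ⟨⟨?_, (hfeas _).2 fun φ hφ => hmax hφ⟩, fun t ht => (hfeas t).1 ht.2 φ₀ hφ₀⟩,
    ⟨φ₀, hφ₀, rfl⟩, ?_⟩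
  · rw [hFe]
    exact div_nonneg (trigForm_re_nonneg hApsd φ₀) (hBpos φ₀).le
  · rintro _ ⟨φ, hφ, rfl⟩
    exact hmax hφ
end
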